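/- Let F = ℚ(√d) with d ≥ 6 squarefree and let H be a totally definite quaternion F-algebra. Then t(H, D₂†) = 1 if H is F-isomorphic to (−1,−1/F), the prime 2 is ramified in F (i.e. d ≡ 2 or 3 (mod 4)), and 2ε ∉ F^{×2}; otherwise t(H, D₂†) = 0. -/

import Mathlib

open NumberField Quaternion

noncomputable section

namespace QuatPaper

variable (F : Type) [Field F] [NumberField F]

def scalarSet (H : Type) [Ring H] [Algebra F H] : Set H :=
  Set.range fun r : 𝓞 F => algebraMap F H (algebraMap (𝓞 F) F r)

def IsOrder {H : Type} [Ring H] [Algebra F H] (O : Subring H) : Prop :=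
  scalarSet F H ⊆ ↑O ∧ O.toAddSubgroup.FG ∧ Submodule.span F (O : Set H) = ⊤

def IsMaximalOrder {H : Type} [Ring H] [Algebra F H] (O : Subring H) : Prop :=
  IsOrder F O ∧ ∀ O' : Subring H, IsOrder F O' → O ≤ O' → O' = O

def IsScalarUnit {H : Type} [Ring H] [Algebra F H] {O : Subring H} (u : (↥O)ˣ) : Prop :=
  ∃ r : (𝓞 F)ˣ, ((u : ↥O) : H) = algebraMap F H (algebraMap (𝓞 F) F ↑r)

def RedUnitIso {H : Type} [Ring H] [Algebra F H] (O : Subring H) (G : Type*) [Group G] : Prop :=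
  ∃ φ : (↥O)ˣ →* G, Function.Surjective φ ∧ ∀ u, φ u = 1 ↔ IsScalarUnit F u

def IsConjugate {H : Type} [Ring H] (x : Hˣ) (O O' : Subring H) : Prop :=
  ∀ y : H, y ∈ O ↔ (x : H) * y * ((x⁻¹ : Hˣ) : H) ∈ O'

def ConjRel {H : Type} [Ring H] (O O' : Subring H) : Prop :=
  ∃ x : Hˣ, IsConjugate x O O'

def typeNum (H : Type) [Ring H] [Algebra F H] (G : Type*) [Group G] : ℕ :=
  Nat.card (Quot fun O O' : {O : Subring H // IsMaximalOrder F O ∧ RedUnitIso F O G} =>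
    ConjRel O.1 O'.1)

def IsQuatAlg (H : Type) [Ring H] [Algebra F H] : Prop :=
  ∃ a b : F, a ≠ 0 ∧ b ≠ 0 ∧ Nonempty (H ≃ₐ[F] ℍ[F, a, b])

def TotallyDefinite (H : Type) [Ring H] [Algebra F H] : Prop :=
  ∀ σ : F →+* ℝ,
    letI : Algebra F ℝ := σ.toAlgebra
    ∀ x : TensorProduct F ℝ H, x ≠ 0 → IsUnit x

/-- The reduced norm `Nr(x) = x·x̄` of a quaternion `x ∈ ℍ[F, A, B]`. -/
def redNorm {A B : F} (x : ℍ[F, A, B]) : F := (x * star x).re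

/-- The reduced unit group of `O` is isomorphic to the dihedral group `D_n` and is
of the *first kind*: every element of order `2` in `O^×/O_F^×` admits a representative
whose reduced norm is the square of a unit of `O_F`. -/
def RedUnitDihedralFirstKind {A B : F} (n : ℕ) (O : Subring ℍ[F, A, B]) : Prop :=
  ∃ φ : (↥O)ˣ →* DihedralGroup n, Function.Surjective φ ∧
    (∀ u, φ u = 1 ↔ IsScalarUnit F u) ∧
    ∀ u : (↥O)ˣ, φ u ≠ 1 → φ u * φ u = 1 →
      ∃ u' : (↥O)ˣ, φ u' = φ u ∧ ∃ r : (𝓞 F)ˣ,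
        redNorm F ((u' : ↥O) : ℍ[F, A, B]) = algebraMap (𝓞 F) F ↑r ^ 2

/-- The reduced unit group of `O` is isomorphic to the dihedral group `D_n` and is
of the *second kind*: some element of order `2` in `O^×/O_F^×` has no representative
whose reduced norm is the square of a unit of `O_F`. -/
def RedUnitDihedralSecondKind {A B : F} (n : ℕ) (O : Subring ℍ[F, A, B]) : Prop :=
  ∃ φ : (↥O)ˣ →* DihedralGroup n, Function.Surjective φ ∧
    (∀ u, φ u = 1 ↔ IsScalarUnit F u) ∧
    ∃ u : (↥O)ˣ, φ u ≠ 1 ∧ φ u * φ u = 1 ∧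
      ∀ u' : (↥O)ˣ, φ u' = φ u → ∀ r : (𝓞 F)ˣ,
        redNorm F ((u' : ↥O) : ℍ[F, A, B]) ≠ algebraMap (𝓞 F) F ↑r ^ 2

/-- `t(H, D_n†)`: the number of conjugacy classes of maximal orders whose reduced unit
group is isomorphic to `D_n` of the first kind. -/
def typeNumDnFirstKind (A B : F) (n : ℕ) : ℕ :=
  Nat.card (Quot fun O O' : {O : Subring ℍ[F, A, B] //
      IsMaximalOrder F O ∧ RedUnitDihedralFirstKind F n O} => ConjRel O.1 O'.1)

/-- `t(H, D_n‡)`: the number of conjugacy classes of maximal orders whose reduced unit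
group is isomorphic to `D_n` of the second kind. -/
def typeNumDnSecondKind (A B : F) (n : ℕ) : ℕ :=
  Nat.card (Quot fun O O' : {O : Subring ℍ[F, A, B] //
      IsMaximalOrder F O ∧ RedUnitDihedralSecondKind F n O} => ConjRel O.1 O'.1)

/-- `ℵ(O₀)`: the number of maximal orders containing `O₀`. -/
def alephNum {H : Type} [Ring H] [Algebra F H] (O₀ : Subring H) : ℕ :=
  Nat.card {O : Subring H // IsMaximalOrder F O ∧ O₀ ≤ O}

/-- `ℶ(O₀)`: the number of orbits of the conjugation action of the normalizer
`N(O₀)` on the set of maximal orders containing `O₀`. -/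
def bethNum {H : Type} [Ring H] [Algebra F H] (O₀ : Subring H) : ℕ :=
  Nat.card (Quot fun O O' : {O : Subring H // IsMaximalOrder F O ∧ O₀ ≤ O} =>
    ∃ x : Hˣ, IsConjugate x O₀ O₀ ∧ IsConjugate x O.1 O'.1)

section Auxiliary

set_option linter.unusedSectionVars false

local notation "cc" => algebraMap (𝓞 F) F

theorem algebraMap_two : cc 2 = 2 := map_ofNat _ 2

theorem algebraMap_four : cc 4 = 4 := map_ofNat _ 4

/-- The order `O_F + O_F j + O_F (u + i + v j)/2 + O_F (v + u j + k)/2` of `(-1,-1/F)`, where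
`u ^ 2 + v ^ 2 + 1 = 4 w`. -/
def splitOrder (u v w : 𝓞 F) (h : u ^ 2 + v ^ 2 + 1 = 4 * w) : Subring ℍ[F, -1, -1] where
  carrier := {x | ∃ p q b d : 𝓞 F, x = ⟨cc p + (cc u * cc b + cc v * cc d) / 2, cc b / 2,
    cc q + (cc v * cc b + cc u * cc d) / 2, cc d / 2⟩}
  zero_mem' := ⟨0, 0, 0, 0, by ext <;> simp⟩
  one_mem' := ⟨1, 0, 0, 0, by ext <;> simp⟩
  add_mem' := by
    rintro _ _ ⟨p, q, b, d, rfl⟩ ⟨p', q', b', d', rfl⟩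
    refine ⟨p + p', q + q', b + b', d + d', ?_⟩
    ext <;> simp <;> ring
  neg_mem' := by
    rintro _ ⟨p, q, b, d, rfl⟩
    refine ⟨-p, -q, -b, -d, ?_⟩
    ext <;> simp <;> ring
  mul_mem' := by
    rintro _ _ ⟨p, q, b, d, rfl⟩ ⟨p', q', b', d', rfl⟩
    have hw : cc u ^ 2 + cc v ^ 2 + 1 = 4 * cc w := by
      simpa [algebraMap_two, algebraMap_four] using congrArg (algebraMap (𝓞 F) F) h
    refine ⟨p*p' - q*q' - u*q*d' - v*b*q' - w*b*b' - u*v*b*d' - w*d*d',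
      p*q' + q*p' + u*q*b' + v*d*q' - w*b*d' + w*d*b',
      p*b' + b*p' + q*d' - d*q' + u*b*b' + v*b*d',
      p*d' + d*p' - q*b' + b*q' + u*b*d' + v*d*d', ?_⟩
    have hw' : cc w = (cc u ^ 2 + cc v ^ 2 + 1) / 4 := by rw [hw]; ring
    ext <;> simp [hw'] <;> ring

/-- The order of `(-1,-1/F)` generated over `O_F` by `i, j, k, (1 + i + j + k)/2, π(i - k)/2` and
`π(j - k)/2`, where `π ^ 2 = 2 m`. -/
def hurwitzOrder (P m : 𝓞 F) (h : P ^ 2 = 2 * m) : Subring ℍ[F, -1, -1] where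
  carrier := {x | ∃ a b₁ c₁ d₁ b₂ c₂ : 𝓞 F, x = ⟨cc a / 2, (cc a + cc P * cc b₂) / 2 + cc b₁,
    (cc a + cc P * cc c₂) / 2 + cc c₁, (cc a - cc P * (cc b₂ + cc c₂)) / 2 + cc d₁⟩}
  zero_mem' := ⟨0, 0, 0, 0, 0, 0, by ext <;> simp⟩
  one_mem' := ⟨2, -1, -1, -1, 0, 0, by ext <;> simp [algebraMap_two]⟩
  add_mem' := by
    rintro _ _ ⟨a, b₁, c₁, d₁, b₂, c₂, rfl⟩ ⟨a', b₁', c₁', d₁', b₂', c₂', rfl⟩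
    refine ⟨a + a', b₁ + b₁', c₁ + c₁', d₁ + d₁', b₂ + b₂', c₂ + c₂', ?_⟩
    ext <;> simp <;> ring
  neg_mem' := by
    rintro _ ⟨a, b₁, c₁, d₁, b₂, c₂, rfl⟩
    refine ⟨-a, -b₁, -c₁, -d₁, -b₂, -c₂, ?_⟩
    ext <;> simp <;> ring
  mul_mem' := by
    rintro _ _ ⟨a, b1, c1, d1, b2, c2, rfl⟩ ⟨a', b1', c1', d1', b2', c2', rfl⟩
    have hm : cc P ^ 2 = 2 * cc m := by
      simpa [algebraMap_two, algebraMap_four] using congrArg (algebraMap (𝓞 F) F) h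
    have hm' : cc m = cc P ^ 2 / 2 := by rw [hm]; ring
    refine ⟨-a*a' - a*b1' - a*c1' - a*d1' - b1*a' - 2*b1*b1' - P*b1*b2' - c1*a' - 2*c1*c1' -
      P*c1*c2' - d1*a' - 2*d1*d1' + P*d1*b2' + P*d1*c2' - P*b2*b1' + P*b2*d1' - 2*m*b2*b2' -
      m*b2*c2' - P*c2*c1' + P*c2*d1' - m*c2*b2' - 2*m*c2*c2', a*a' + a*b1' + a*d1' + b1*a'
      + b1*b1' + c1*a' + c1*c1' + c1*d1' - d1*c1' + d1*d1' +
      m*b2*b2' + m*b2*c2' + m*c2*c2', a*a' + a*b1' + a*c1' + b1*b1' - b1*d1' + c1*a' + c1*c1'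
      + d1*a' + d1*b1' + d1*d1' +
      m*b2*b2' + m*b2*c2' + m*c2*c2', a*a' + a*c1' + a*d1' + b1*a' + b1*b1' + b1*c1'
      + 2*P*b1*b2' + P*b1*c2' - c1*b1' + c1*c1'
      - P*c1*b2' + P*c1*c2' + d1*a' + d1*d1' - P*d1*b2' - 2*P*d1*c2' + P*b2*b1' + P*b2*c1' -
      2*P*b2*d1' + m*b2*b2' + m*b2*c2' - P*c2*b1' + 2*P*c2*c1' - P*c2*d1' + m*c2*c2', - a*c2'
      + b1*b2' - c1*b2' - d1*b2' - 2*d1*c2' + b2*a' + b2*b1' + b2*c1' - b2*d1' + c2*a'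
      + 2*c2*c1', a*b2' + a*c2' + 2*b1*b2' + b1*c2'
      + c1*c2' - d1*c2' - b2*a' - 2*b2*d1' - c2*b1' + c2*c1'
      - c2*d1', ?_⟩
    ext <;> simp [hm', algebraMap_two] <;> ring

variable {F}

theorem isIntegral_of_mem_fg {H : Type} [Ring H] {O : Subring H} (hO : O.toAddSubgroup.FG) {x : H}
    (hx : x ∈ O) : IsIntegral ℤ x := by
  refine IsIntegral.of_mem_of_fg (subalgebraOfSubring O) ?_ x hx
  rw [Submodule.fg_iff_addSubgroup_fg]
  exact hO

theorem isIntegral_star {A B : F} {x : ℍ[F, A, B]} (hx : IsIntegral ℤ x) :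
    IsIntegral ℤ (star x) := by
  obtain ⟨p, hp, h0⟩ := hx
  refine ⟨p, hp, ?_⟩
  rw [← Polynomial.aeval_def] at h0 ⊢
  have := congrArg star h0
  simpa [Polynomial.aeval_eq_sum_range, star_sum, ← Int.cast_smul_eq_zsmul F,
    QuaternionAlgebra.star_smul'] using this

theorem isIntegral_two_re_and_norm {A B : F} {x : ℍ[F, A, B]} (hx : IsIntegral ℤ x) :
    IsIntegral ℤ (2 * x.re) ∧ IsIntegral ℤ (redNorm F x) := by
  let S := Algebra.adjoin F {x}
  let y : S := ⟨x, Algebra.subset_adjoin rfl⟩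
  let t : S := algebraMap F S (x.re + x.re)
  have hinj : Function.Injective (S.val.restrictScalars ℤ) := Subtype.val_injective
  have hy : IsIntegral ℤ y := (isIntegral_algHom_iff (S.val.restrictScalars ℤ) hinj).1 hx
  have hz : IsIntegral ℤ (t - y) := by
    refine (isIntegral_algHom_iff (S.val.restrictScalars ℤ) hinj).1 ?_
    convert isIntegral_star hx using 1
    rw [QuaternionAlgebra.star_eq_two_re_sub, zero_mul, add_zero, two_mul]
    rfl
  have hS : Function.Injective (algebraMap F S) := FaithfulSMul.algebraMap_injective F S
  constructor
  · have := hy.add hz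
    rw [add_sub_cancel] at this
    rw [two_mul]
    exact (isIntegral_algHom_iff ((Algebra.ofId F S).restrictScalars ℤ) hS).1 this
  · have := hy.mul hz
    refine (isIntegral_algHom_iff ((Algebra.ofId F S).restrictScalars ℤ) hS).1 ?_
    have e : algebraMap F S (redNorm F x) = y * (t - y) := by
      apply Subtype.ext
      change algebraMap F _ _ = x * (algebraMap F _ (x.re + x.re) - x)
      ext <;> simp [redNorm] <;> ring
    change IsIntegral ℤ (algebraMap F S _)
    rw [e]
    exact this

theorem exists_ringOfIntegers {x : F} (hx : IsIntegral ℤ x) : ∃ a : 𝓞 F, cc a = x :=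
  ⟨⟨x, hx⟩, rfl⟩

/-- `P` is a ring of quaternions between `O_F⟨i, j⟩` and its dual, with integral norms. -/
structure IsHalfIntegral (P : Subring ℍ[F, -1, -1]) : Prop where
  scalar_mem : ∀ r : 𝓞 F, algebraMap F ℍ[F, -1, -1] (cc r) ∈ P
  i_mem : (⟨0, 1, 0, 0⟩ : ℍ[F, -1, -1]) ∈ P
  j_mem : (⟨0, 0, 1, 0⟩ : ℍ[F, -1, -1]) ∈ P
  exists_half : ∀ x ∈ P, ∃ a b c d N : 𝓞 F,
    x = ⟨cc a / 2, cc b / 2, cc c / 2, cc d / 2⟩ ∧ a ^ 2 + b ^ 2 + c ^ 2 + d ^ 2 = 4 * N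

theorem IsOrder.exists_two_re {A B : F} {P : Subring ℍ[F, A, B]} (hP : IsOrder F P)
    {x : ℍ[F, A, B]} (hx : x ∈ P) : ∃ a : 𝓞 F, cc a = 2 * x.re :=
  exists_ringOfIntegers (isIntegral_two_re_and_norm (isIntegral_of_mem_fg hP.2.1 hx)).1

theorem IsOrder.isHalfIntegral {P : Subring ℍ[F, -1, -1]} (hP : IsOrder F P)
    (hi : (⟨0, 1, 0, 0⟩ : ℍ[F, -1, -1]) ∈ P) (hj : (⟨0, 0, 1, 0⟩ : ℍ[F, -1, -1]) ∈ P) :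
    IsHalfIntegral P := by
  refine ⟨fun r => hP.1 ⟨r, rfl⟩, hi, hj, fun x hx => ?_⟩
  obtain ⟨a, ha⟩ := hP.exists_two_re hx
  obtain ⟨b, hb⟩ := hP.exists_two_re (P.mul_mem hx hi)
  obtain ⟨c, hc⟩ := hP.exists_two_re (P.mul_mem hx hj)
  obtain ⟨d, hd⟩ := hP.exists_two_re (P.mul_mem hx (P.mul_mem hi hj))
  obtain ⟨N, hN⟩ := exists_ringOfIntegers
    (isIntegral_two_re_and_norm (isIntegral_of_mem_fg hP.2.1 hx)).2
  simp at hb hc hd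
  simp [redNorm] at hN
  refine ⟨a, -b, -c, -d, N, ?_, ?_⟩
  · ext <;> simp [ha, hb, hc, hd]
  · apply RingOfIntegers.coe_injective
    simp [ha, hb, hc, hd, hN, algebraMap_four]
    ring

namespace IsHalfIntegral

variable {P : Subring ℍ[F, -1, -1]} (hP : IsHalfIntegral P)
include hP

theorem isOrder : IsOrder F P := by
  have hk : (⟨0, 0, 0, 1⟩ : ℍ[F, -1, -1]) ∈ P := by
    convert P.mul_mem hP.i_mem hP.j_mem using 1
    ext <;> simp
  refine ⟨?_, ?_, ?_⟩
  · rintro _ ⟨r, rfl⟩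
    exact hP.scalar_mem r
  · let f : (Fin 4 → 𝓞 F) →ₗ[ℤ] ℍ[F, -1, -1] :=
      { toFun := fun v => ⟨cc (v 0) / 2, cc (v 1) / 2, cc (v 2) / 2, cc (v 3) / 2⟩
        map_add' := fun v w => by ext <;> simp [add_div]
        map_smul' := fun z v => by ext <;> simp [mul_div_assoc] }
    have hf : f.range.FG := by
      rw [LinearMap.range_eq_map]
      exact (Module.finite_def.1 inferInstance).map f
    have hle : AddSubgroup.toIntSubmodule P.toAddSubgroup ≤ f.range := by
      intro x hx
      obtain ⟨a, b, c, d, _, rfl, _⟩ := hP.exists_half x hx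
      exact ⟨![a, b, c, d], rfl⟩
    have : (AddSubgroup.toIntSubmodule P.toAddSubgroup).FG := by
      have : Module.Finite ℤ f.range := .of_fg hf
      have := isNoetherian_submodule.1 (isNoetherian_of_isNoetherianRing_of_finite ℤ f.range)
      exact this _ hle
    rwa [Submodule.fg_iff_addSubgroup_fg] at this
  · rw [eq_top_iff]
    intro x _
    have h1 := Submodule.smul_mem _ x.re (Submodule.subset_span (R := F) P.one_mem)
    have h2 := Submodule.smul_mem _ x.imI (Submodule.subset_span (R := F) hP.i_mem)
    have h3 := Submodule.smul_mem _ x.imJ (Submodule.subset_span (R := F) hP.j_mem)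
    have h4 := Submodule.smul_mem _ x.imK (Submodule.subset_span (R := F) hk)
    convert add_mem (add_mem h1 h2) (add_mem h3 h4) using 1
    ext <;> simp

theorem smul_mem (r : 𝓞 F) {a b c d : F} (h : (⟨a, b, c, d⟩ : ℍ[F, -1, -1]) ∈ P) :
    (⟨cc r * a, cc r * b, cc r * c, cc r * d⟩ : ℍ[F, -1, -1]) ∈ P := by
  convert P.mul_mem (hP.scalar_mem r) h using 1
  rw [QuaternionAlgebra.algebraMap_eq]
  ext <;> simp

theorem i_mul_mem {a b c d : F} (h : (⟨a, b, c, d⟩ : ℍ[F, -1, -1]) ∈ P) :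
    (⟨-b, a, -d, c⟩ : ℍ[F, -1, -1]) ∈ P := by
  convert P.mul_mem hP.i_mem h using 1
  ext <;> simp

theorem j_mul_mem {a b c d : F} (h : (⟨a, b, c, d⟩ : ℍ[F, -1, -1]) ∈ P) :
    (⟨-c, d, a, -b⟩ : ℍ[F, -1, -1]) ∈ P := by
  convert P.mul_mem hP.j_mem h using 1
  ext <;> simp

theorem add_int_mem {a b c d : F} (h : (⟨a, b, c, d⟩ : ℍ[F, -1, -1]) ∈ P) (p q r s : 𝓞 F) :
    (⟨a + cc p, b + cc q, c + cc r, d + cc s⟩ : ℍ[F, -1, -1]) ∈ P := by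
  have h1 := hP.scalar_mem p
  have h2 := hP.smul_mem q hP.i_mem
  have h3 := hP.smul_mem r hP.j_mem
  have h4 := hP.smul_mem s (hP.i_mul_mem hP.j_mem)
  convert P.add_mem h (P.add_mem (P.add_mem h1 h2) (P.add_mem h3 h4)) using 1
  rw [QuaternionAlgebra.algebraMap_eq]
  ext <;> simp

end IsHalfIntegral

theorem splitOrder_isHalfIntegral {u v w : 𝓞 F} (h : u ^ 2 + v ^ 2 + 1 = 4 * w) :
    IsHalfIntegral (splitOrder F u v w h) := by
  refine ⟨fun r => ⟨r, 0, 0, 0, ?_⟩, ⟨-u, -v, 2, 0, ?_⟩, ⟨0, 1, 0, 0, ?_⟩, ?_⟩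
  · rw [QuaternionAlgebra.algebraMap_eq]
    ext <;> simp
  · ext <;> simp [algebraMap_two]
  · ext <;> simp
  · rintro _ ⟨p, q, b, d, rfl⟩
    refine ⟨2 * p + u * b + v * d, b, 2 * q + v * b + u * d, d,
      p ^ 2 + q ^ 2 + p * (u * b + v * d) + q * (v * b + u * d) + u * v * b * d
        + w * (b ^ 2 + d ^ 2), ?_, ?_⟩
    · ext <;> simp [algebraMap_two] <;> ring
    · linear_combination (b ^ 2 + d ^ 2) * h

theorem hurwitzOrder_isHalfIntegral {π m : 𝓞 F} (h : π ^ 2 = 2 * m) :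
    IsHalfIntegral (hurwitzOrder F π m h) := by
  refine ⟨fun r => ⟨2 * r, -r, -r, -r, 0, 0, ?_⟩, ⟨0, 1, 0, 0, 0, 0, ?_⟩,
    ⟨0, 0, 1, 0, 0, 0, ?_⟩, ?_⟩
  · rw [QuaternionAlgebra.algebraMap_eq]
    ext <;> simp [algebraMap_two]
  · ext <;> simp
  · ext <;> simp
  · rintro _ ⟨a, b₁, c₁, d₁, b₂, c₂, rfl⟩
    refine ⟨a, a + π * b₂ + 2 * b₁, a + π * c₂ + 2 * c₁, a - π * (b₂ + c₂) + 2 * d₁,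
      a ^ 2 + b₁ ^ 2 + c₁ ^ 2 + d₁ ^ 2 + b₁ * (a + π * b₂) + c₁ * (a + π * c₂)
        + d₁ * (a - π * (b₂ + c₂)) + m * (b₂ ^ 2 + c₂ ^ 2 + b₂ * c₂), ?_, ?_⟩
    · ext <;> simp [algebraMap_two] <;> ring
    · linear_combination (2 * (b₂ ^ 2 + c₂ ^ 2 + b₂ * c₂)) * h

theorem mem_hurwitzOrder {π m : 𝓞 F} (h : π ^ 2 = 2 * m) :
    (⟨1 / 2, 1 / 2, 1 / 2, 1 / 2⟩ : ℍ[F, -1, -1]) ∈ hurwitzOrder F π m h :=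
  ⟨1, 0, 0, 0, 0, 0, by ext <;> simp⟩

theorem mem_splitOrder {u v w : 𝓞 F} (h : u ^ 2 + v ^ 2 + 1 = 4 * w) :
    (⟨cc u / 2, 1 / 2, cc v / 2, 0⟩ : ℍ[F, -1, -1]) ∈ splitOrder F u v w h :=
  ⟨0, 0, 1, 0, by ext <;> simp⟩

/-- An order containing `i`, `j` and `(u + i + v j)/2` equals `splitOrder`. -/
theorem IsHalfIntegral.eq_splitOrder {P : Subring ℍ[F, -1, -1]} (hP : IsHalfIntegral P)
    {u v w : 𝓞 F} (h : u ^ 2 + v ^ 2 + 1 = 4 * w)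
    (he : (⟨cc u / 2, 1 / 2, cc v / 2, 0⟩ : ℍ[F, -1, -1]) ∈ P) : P = splitOrder F u v w h := by
  have hw : cc u ^ 2 + cc v ^ 2 + 1 = 4 * cc w := by
    simpa [algebraMap_four] using congrArg (algebraMap (𝓞 F) F) h
  have hf : (⟨cc v / 2, 0, cc u / 2, 1 / 2⟩ : ℍ[F, -1, -1]) ∈ P := by
    convert P.neg_mem (hP.add_int_mem (hP.j_mul_mem he) 0 0 (-u) 0) using 1
    ext <;> simp
    ring
  apply le_antisymm
  · intro x hx
    obtain ⟨a, b, c, d, N, rfl, hN⟩ := hP.exists_half x hx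
    obtain ⟨s, hs⟩ := hP.isOrder.exists_two_re (P.mul_mem he hx)
    obtain ⟨t, ht⟩ := hP.isOrder.exists_two_re (P.mul_mem hf hx)
    simp at hs ht
    have hs' : cc b = cc u * cc a - cc v * cc c - 2 * cc s := by linear_combination 2 * hs
    have ht' : cc d = cc v * cc a - cc u * cc c - 2 * cc t := by linear_combination 2 * ht
    have hw' : cc w = (cc u ^ 2 + cc v ^ 2 + 1) / 4 := by rw [hw]; ring
    refine ⟨a - 2 * w * a + u * v * c + u * s + v * t, 2 * w * c - u * v * a + v * s + u * t,
      b, d, ?_⟩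
    ext <;> simp [hs', ht', hw', algebraMap_two] <;> ring
  · rintro _ ⟨p, q, b, d, rfl⟩
    convert hP.add_int_mem (P.add_mem (hP.smul_mem b he) (hP.smul_mem d hf)) p 0 q 0 using 1
    ext <;> simp <;> ring

section QuadraticField

theorem rat_mem_int_of_squarefree_mul_sq {d : ℕ} (hd : Squarefree d) {s : ℚ} {M : ℤ}
    (h : (d : ℚ) * s ^ 2 = M) : ∃ S : ℤ, s = S := by
  have hden : (s.den : ℚ) ≠ 0 := by exact_mod_cast s.den_nz
  have h1 : (d : ℤ) * s.num ^ 2 = M * (s.den : ℤ) ^ 2 := by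
    have h2 : (d : ℚ) * s.num ^ 2 = M * (s.den : ℚ) ^ 2 := by
      rw [← h]
      have := Rat.mul_den_eq_num s
      rw [← this]
      ring
    exact_mod_cast h2
  have h2 : s.den ^ 2 ∣ d := by
    have h3 : ((s.den : ℤ)) ^ 2 ∣ (d : ℤ) * s.num ^ 2 := ⟨M, by rw [h1]; ring⟩
    have h4 : IsCoprime ((s.den : ℤ) ^ 2) (s.num ^ 2) := by
      apply IsCoprime.pow
      rw [Int.isCoprime_iff_gcd_eq_one, Int.gcd_comm]
      simpa [Int.gcd] using s.reduced
    exact_mod_cast h4.dvd_of_dvd_mul_right h3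
  have h3 : s.den = 1 := by
    rw [sq] at h2
    simpa using hd _ h2
  exact ⟨s.num, ((Rat.den_eq_one_iff s).1 h3).symm⟩

theorem sq_ne_of_squarefree {d : ℕ} (hd6 : 6 ≤ d) (hd : Squarefree d) (r : ℚ) :
    r ^ 2 ≠ (d : ℚ) := by
  intro h
  obtain ⟨n, hn⟩ := (Rat.isSquare_natCast_iff (n := d)).1 ⟨r, by rw [← h, sq]⟩
  have := hd n ⟨1, by rw [hn]; ring⟩
  simp at this
  subst this
  omega

variable {d : ℕ} (hd6 : 6 ≤ d) (hdsf : Squarefree d) {s : F} (hs : s ^ 2 = (d : F))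
include hd6 hdsf hs

theorem eq_zero_of_add_mul_sqrt {p q : ℚ} (h : (p : F) + q * s = 0) : p = 0 ∧ q = 0 := by
  have hq : q = 0 := by
    by_contra hq
    have hqF : (q : F) ≠ 0 := by exact_mod_cast hq
    refine sq_ne_of_squarefree hd6 hdsf (-p / q) ?_
    have : (((-p / q : ℚ) : F)) = s := by
      push_cast
      field_simp
      linear_combination -h
    have h2 : (((-p / q : ℚ) ^ 2 : ℚ) : F) = (d : ℚ) := by
      push_cast at this ⊢
      rw [this, hs]
    exact_mod_cast h2
  subst hq
  simpa using h

theorem exists_int_of_isIntegral (hgen : Algebra.adjoin ℚ {s} = ⊤) {z : F} (hz : IsIntegral ℤ z) :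
    ∃ T S N : ℤ, 2 * z = T + S * s ∧ T ^ 2 - d * S ^ 2 = 4 * N := by
  let L : QuadraticAlgebra ℚ (d : ℚ) 0 →ₐ[ℚ] F := QuadraticAlgebra.lift ⟨s, by
    rw [← sq, hs]; simp [Algebra.smul_def]⟩
  have hL : ∀ x, L x = (x.re : F) + x.im * s := by
    intro x
    simp [L, QuadraticAlgebra.lift, Algebra.smul_def]
  have hLi : Function.Injective L := by
    rw [injective_iff_map_eq_zero]
    intro x hx
    rw [hL] at hx
    obtain ⟨h1, h2⟩ := eq_zero_of_add_mul_sqrt hd6 hdsf hs hx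
    ext <;> simp [h1, h2]
  have hLs : z ∈ L.range := by
    have h1 : Algebra.adjoin ℚ {s} ≤ L.range := by
      rw [Algebra.adjoin_le_iff, Set.singleton_subset_iff]
      exact ⟨⟨0, 1⟩, by
        change L _ = s
        simp [hL]⟩
    rw [hgen] at h1
    exact h1 trivial
  obtain ⟨x, rfl⟩ := hLs
  have hx : IsIntegral ℤ x := by
    have := (isIntegral_algHom_iff (L.restrictScalars ℤ) hLi).1 hz
    exact this
  have hx' : IsIntegral ℤ (star x) := map_isIntegral_int (starRingEnd _) hx
  have key : ∀ r : ℚ, IsIntegral ℤ (algebraMap ℚ (QuadraticAlgebra ℚ (d : ℚ) 0) r) →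
      ∃ n : ℤ, (n : ℚ) = r := by
    intro r hr
    have : IsIntegral ℤ r := by
      refine (isIntegral_algHom_iff
        ((Algebra.ofId ℚ (QuadraticAlgebra ℚ (d : ℚ) 0)).restrictScalars ℤ) ?_).1 hr
      intro a b hab
      simpa [Algebra.ofId_apply] using congrArg QuadraticAlgebra.re hab
    exact IsIntegrallyClosed.isIntegral_iff.1 this
  obtain ⟨T, hT⟩ := key (2 * x.re) (by
    convert hx.add hx' using 1
    ext <;> simp
    ring)
  obtain ⟨N, hN⟩ := key (x.re ^ 2 - d * x.im ^ 2) (by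
    convert hx.mul hx' using 1
    rw [← QuadraticAlgebra.algebraMap_norm_eq_mul_star, QuadraticAlgebra.norm_def]
    congr 1
    ring)
  obtain ⟨S, hS⟩ := rat_mem_int_of_squarefree_mul_sq hdsf (s := 2 * x.im) (M := T ^ 2 - 4 * N) (by
    push_cast
    rw [hT, hN]
    ring)
  refine ⟨T, S, N, ?_, ?_⟩
  · change 2 * L x = _
    rw [hL]
    have h1 : (T : F) = ((2 * x.re : ℚ) : F) := by rw [← hT]; simp
    have h2 : (S : F) = ((2 * x.im : ℚ) : F) := by rw [hS]; simp
    rw [h1, h2]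
    push_cast
    ring
  · have : ((T ^ 2 - d * S ^ 2 : ℤ) : ℚ) = (4 * N : ℤ) := by
      push_cast
      rw [← hS, hT, hN]
      ring
    exact_mod_cast this

theorem exists_basis_of_ramified (hgen : Algebra.adjoin ℚ {s} = ⊤) (hd : d % 4 = 2 ∨ d % 4 = 3) :
    ∃ θ : 𝓞 F, cc θ = s ∧ θ ^ 2 = d ∧ (∀ a : 𝓞 F, ∃ m n : ℤ, a = m + n * θ) ∧
      ∀ m n : ℤ, (m + n * θ : 𝓞 F) = 0 → m = 0 ∧ n = 0 := by
  have hint : IsIntegral ℤ s := by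
    refine ⟨Polynomial.X ^ 2 - Polynomial.C (d : ℤ), Polynomial.monic_X_pow_sub_C _ two_ne_zero, ?_⟩
    simp [hs]
  obtain ⟨θ, hθ⟩ := exists_ringOfIntegers hint
  refine ⟨θ, hθ, ?_, fun a => ?_, fun m n h => ?_⟩
  · apply RingOfIntegers.coe_injective
    simp [hθ, hs]
  · obtain ⟨T, S, N, h1, h2⟩ := exists_int_of_isIntegral hd6 hdsf hs hgen a.isIntegral_coe
    obtain ⟨T', rfl⟩ : ∃ T', T = 2 * T' := by
      rcases Int.even_or_odd' T with ⟨T', rfl | rfl⟩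
      · exact ⟨T', rfl⟩
      · exfalso
        rcases Int.even_or_odd' S with ⟨S', rfl | rfl⟩
        · ring_nf at h2; omega
        · obtain ⟨D, hD | hD⟩ : ∃ D : ℤ, (d : ℤ) = 4 * D + 2 ∨ (d : ℤ) = 4 * D + 3 :=
            ⟨d / 4, by omega⟩ <;> rw [hD] at h2 <;> ring_nf at h2 <;> omega
    obtain ⟨S', rfl⟩ : ∃ S', S = 2 * S' := by
      rcases Int.even_or_odd' S with ⟨S', rfl | rfl⟩
      · exact ⟨S', rfl⟩
      · exfalso
        ring_nf at h2
        obtain ⟨D, hD | hD⟩ : ∃ D : ℤ, (d : ℤ) = 4 * D + 2 ∨ (d : ℤ) = 4 * D + 3 :=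
            ⟨d / 4, by omega⟩ <;> rw [hD] at h2 <;> ring_nf at h2 <;> omega
    refine ⟨T', S', ?_⟩
    apply RingOfIntegers.coe_injective
    have h2 : (2 : F) ≠ 0 := two_ne_zero
    apply mul_left_cancel₀ h2
    simp only [map_add, map_mul, map_intCast, hθ]
    rw [h1]
    push_cast
    ring
  · have := congrArg (algebraMap (𝓞 F) F) h
    simp only [map_add, map_mul, map_intCast, hθ, map_zero] at this
    have := eq_zero_of_add_mul_sqrt hd6 hdsf hs (p := m) (q := n) (by exact_mod_cast this)
    exact_mod_cast this

theorem exists_basis_of_unramified (hgen : Algebra.adjoin ℚ {s} = ⊤)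
    {D : ℤ} (hD : (d : ℤ) = 4 * D + 1) :
    ∃ θ : 𝓞 F, θ ^ 2 = θ + D ∧ (∀ a : 𝓞 F, ∃ m n : ℤ, a = m + n * θ) ∧
      ∀ m n : ℤ, (m + n * θ : 𝓞 F) = 0 → m = 0 ∧ n = 0 := by
  have hDF : (d : F) = 4 * D + 1 := by exact_mod_cast congrArg (Int.cast : ℤ → F) hD
  have hθs : ((1 + s) / 2) ^ 2 = (1 + s) / 2 + D := by
    rw [hDF] at hs
    linear_combination hs / 4
  have hint : IsIntegral ℤ ((1 + s) / 2) := by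
    refine ⟨Polynomial.X ^ 2 + (-(Polynomial.X + Polynomial.C (D : ℤ))),
      Polynomial.monic_X_pow_add ?_, ?_⟩
    · rw [Polynomial.degree_neg]
      exact lt_of_le_of_lt (Polynomial.degree_X_add_C _).le (by norm_num)
    · simp only [Polynomial.eval₂_add, Polynomial.eval₂_neg, Polynomial.eval₂_X_pow,
        Polynomial.eval₂_X, Polynomial.eval₂_C, hθs]
      simp
  obtain ⟨θ, hθ⟩ := exists_ringOfIntegers hint
  refine ⟨θ, ?_, fun a => ?_, fun m n h => ?_⟩
  · apply RingOfIntegers.coe_injective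
    simpa [hθ] using hθs
  · obtain ⟨T, S, N, h1, h2⟩ := exists_int_of_isIntegral hd6 hdsf hs hgen a.isIntegral_coe
    obtain ⟨k, hk⟩ : ∃ k, T = S + 2 * k := by
      rw [hD] at h2
      rcases Int.even_or_odd' T with ⟨T', rfl | rfl⟩ <;>
      rcases Int.even_or_odd' S with ⟨S', rfl | rfl⟩
      · exact ⟨T' - S', by ring⟩
      · exfalso; ring_nf at h2; omega
      · exfalso; ring_nf at h2; omega
      · exact ⟨T' - S', by ring⟩
    refine ⟨k, S, ?_⟩
    apply RingOfIntegers.coe_injective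
    have h2 : (2 : F) ≠ 0 := two_ne_zero
    apply mul_left_cancel₀ h2
    simp only [map_add, map_mul, map_intCast, hθ]
    rw [h1, hk]
    push_cast
    ring
  · have := congrArg (algebraMap (𝓞 F) F) h
    simp only [map_add, map_mul, map_intCast, hθ, map_zero] at this
    have := eq_zero_of_add_mul_sqrt hd6 hdsf hs (p := m + n / 2) (q := n / 2) (by
      push_cast; linear_combination this)
    obtain ⟨h1, h2⟩ := this
    have hn : (n : ℚ) = 0 := by linarith
    have hm : (m : ℚ) = 0 := by linarith
    exact_mod_cast And.intro hm hn

end QuadraticField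

section FundamentalUnit

variable {σ₀ : F →+* ℝ} {ε : (𝓞 F)ˣ} (hε : 1 < σ₀ (algebraMap (𝓞 F) F ↑ε))
  (hεfund : ∀ u : (𝓞 F)ˣ, 1 < σ₀ (algebraMap (𝓞 F) F ↑u) →
    σ₀ (algebraMap (𝓞 F) F ↑ε) ≤ σ₀ (algebraMap (𝓞 F) F ↑u))
include hε hεfund

theorem unit_eq_zpow_of_pos {u : (𝓞 F)ˣ} (hu : 0 < σ₀ (cc ↑u)) : ∃ k : ℤ, u = ε ^ k := by
  let f : (𝓞 F)ˣ →* ℝˣ := Units.map ((σ₀.comp (algebraMap (𝓞 F) F)) : 𝓞 F →* ℝ)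
  have hf : ∀ v, ((f v : ℝˣ) : ℝ) = σ₀ (cc ↑v) := fun v => rfl
  obtain ⟨k, hk1, hk2⟩ := exists_mem_Ico_zpow hu hε
  have hv : σ₀ (cc ((u * ε ^ (-k) : (𝓞 F)ˣ) : 𝓞 F)) = σ₀ (cc ↑u) / σ₀ (cc ↑ε) ^ k := by
    rw [← hf, map_mul, map_zpow, Units.val_mul, Units.val_zpow_eq_zpow_val, hf, hf, zpow_neg]
    rfl
  have hpos : 0 < σ₀ (cc ↑ε) ^ k := zpow_pos (by linarith) k
  refine ⟨k, ?_⟩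
  rcases hk1.lt_or_eq with h | h
  · have h1 := hεfund (u * ε ^ (-k)) (by rwa [hv, one_lt_div hpos])
    rw [hv, le_div_iff₀ hpos] at h1
    rw [zpow_add_one₀ (by linarith)] at hk2
    linarith
  · rw [h, div_self hu.ne'] at hv
    have : ((u * ε ^ (-k) : (𝓞 F)ˣ) : 𝓞 F) = 1 := by
      apply RingOfIntegers.coe_injective
      apply σ₀.injective
      rw [hv]
      simp
    have := Units.ext (this.trans Units.val_one.symm)
    rwa [zpow_neg, mul_inv_eq_one] at this

theorem fundamentalUnit_ne_sq (t : F) : cc ↑ε ≠ t ^ 2 := by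
  intro h
  have ht : IsIntegral ℤ t := by
    refine IsIntegral.of_pow two_pos ?_
    rw [← h]
    exact RingOfIntegers.isIntegral_coe _
  obtain ⟨a, rfl⟩ := exists_ringOfIntegers ht
  have ha : (ε : 𝓞 F) = a ^ 2 := RingOfIntegers.coe_injective (by simpa using h)
  have hau : a * (a * ↑ε⁻¹) = 1 := by
    rw [← mul_assoc, ← sq, ← ha]
    simp
  let b : (𝓞 F)ˣ := Units.mkOfMulEqOne _ _ hau
  have hb : (b : 𝓞 F) = a := rfl
  have hsq : σ₀ (cc ↑ε) = σ₀ (cc ↑b) ^ 2 := by rw [hb, h]; simp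
  rcases lt_or_ge (σ₀ (cc ↑b)) 0 with h0 | h0
  · have h1 := hεfund (-b) (by simp; nlinarith)
    simp at h1
    nlinarith
  · have h1 := hεfund b (by nlinarith)
    nlinarith

end FundamentalUnit

/-- Residues modulo `2` of elements `m + n θ` of a quadratic ring `ℤ[θ]`. -/
abbrev Residue := Bool × Bool

/-- Residues modulo `2` of the doubled coordinates of a quaternion. -/
abbrev ResidueVec := Residue × Residue × Residue × Residue

namespace Residue

def add (a b : Residue) : Residue := (a.1 ^^ b.1, a.2 ^^ b.2)

/-- Multiplication by `θ`, where `θ ^ 2 = e θ + D`. -/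
def theta (e D : Bool) (a : Residue) : Residue := (D && a.2, a.1 ^^ (e && a.2))

/-- The standard lift of a residue. -/
def lift (θ : 𝓞 F) (a : Residue) : 𝓞 F := (a.1.toNat : 𝓞 F) + (a.2.toNat : 𝓞 F) * θ

theorem exists_lift_add (θ : 𝓞 F) (a b : Residue) :
    ∃ p, lift θ a + lift θ b = lift θ (add a b) + 2 * p := by
  rcases a with ⟨_ | _, _ | _⟩ <;> rcases b with ⟨_ | _, _ | _⟩ <;>
    simp [lift, add] <;>
    first
    | exact ⟨0, by ring1⟩ | exact ⟨1, by ring1⟩ | exact ⟨θ, by ring1⟩ | exact ⟨1 + θ, by ring1⟩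

theorem exists_theta_mul_lift {θ : 𝓞 F} {e : Bool} {D : ℕ} (hθ : θ ^ 2 = e.toNat * θ + D)
    (a : Residue) : ∃ p, θ * lift θ a = lift θ (theta e (D.bodd) a) + 2 * p := by
  have hD : (D : 𝓞 F) = D.bodd.toNat + 2 * D.div2 := by
    have := Nat.bodd_add_div2 D
    exact_mod_cast congrArg (Nat.cast : ℕ → 𝓞 F) this.symm
  have h : θ * lift θ a = a.1.toNat * θ + a.2.toNat * θ ^ 2 := by simp [lift]; ring
  rw [h, hθ, hD]
  rcases a with ⟨_ | _, _ | _⟩ <;> rcases e with _ | _ <;> cases D.bodd <;>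
    simp [lift, theta] <;>
    first
    | exact ⟨0, by ring1⟩ | exact ⟨D.div2, by ring1⟩ | exact ⟨D.div2 + θ, by ring1⟩

theorem exists_eq_lift_add {θ : 𝓞 F} (hb : ∀ a : 𝓞 F, ∃ m n : ℤ, a = m + n * θ) (a : 𝓞 F) :
    ∃ r p, a = lift θ r + 2 * p := by
  obtain ⟨m, n, rfl⟩ := hb a
  refine ⟨(m.bodd, n.bodd), m.div2 + n.div2 * θ, ?_⟩
  have key : ∀ k : ℤ, (k : 𝓞 F) = k.bodd.toNat + 2 * k.div2 := by
    intro k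
    have h : k = k.bodd.toNat + 2 * k.div2 := by
      conv_lhs => rw [← Int.bodd_add_div2 k]
      cases k.bodd <;> rfl
    exact_mod_cast congrArg (Int.cast : ℤ → 𝓞 F) h
  simp only [lift]
  linear_combination key m + θ * key n

end Residue

namespace ResidueVec

def add (v w : ResidueVec) : ResidueVec :=
  (v.1.add w.1, v.2.1.add w.2.1, v.2.2.1.add w.2.2.1, v.2.2.2.add w.2.2.2)

def theta (e D : Bool) (v : ResidueVec) : ResidueVec :=
  (v.1.theta e D, v.2.1.theta e D, v.2.2.1.theta e D, v.2.2.2.theta e D)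

def mulI (v : ResidueVec) : ResidueVec := (v.2.1, v.1, v.2.2.2, v.2.2.1)

def mulJ (v : ResidueVec) : ResidueVec := (v.2.2.1, v.2.2.2, v.1, v.2.1)

/-- The quaternion with half the lifts of the residues as coordinates. -/
def half (θ : 𝓞 F) (v : ResidueVec) : ℍ[F, -1, -1] :=
  ⟨cc (v.1.lift θ) / 2, cc (v.2.1.lift θ) / 2, cc (v.2.2.1.lift θ) / 2, cc (v.2.2.2.lift θ) / 2⟩

/-- The condition that `half θ v` has integral norm, where `θ ^ 2 = e θ + D`. -/
def IsValid (e : Bool) (D : ℕ) (v : ResidueVec) : Prop :=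
  (v.1.1.toNat + v.2.1.1.toNat + v.2.2.1.1.toNat + v.2.2.2.1.toNat +
    D * (v.1.2.toNat + v.2.1.2.toNat + v.2.2.1.2.toNat + v.2.2.2.2.toNat)) % 4 = 0 ∧
  (e.toNat * (v.1.2.toNat + v.2.1.2.toNat + v.2.2.1.2.toNat + v.2.2.2.2.toNat) +
    2 * ((v.1.1 && v.1.2).toNat + (v.2.1.1 && v.2.1.2).toNat + (v.2.2.1.1 && v.2.2.1.2).toNat +
      (v.2.2.2.1 && v.2.2.2.2).toNat)) % 4 = 0

instance (e : Bool) (D : ℕ) (v : ResidueVec) : Decidable (IsValid e D v) :=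
  inferInstanceAs (Decidable (_ ∧ _))

end ResidueVec

namespace IsHalfIntegral

variable {P : Subring ℍ[F, -1, -1]} (hP : IsHalfIntegral P) {θ : 𝓞 F}
include hP

theorem half_mem {a b c d : 𝓞 F}
    (h : (⟨cc a / 2, cc b / 2, cc c / 2, cc d / 2⟩ : ℍ[F, -1, -1]) ∈ P) {v : ResidueVec}
    (ha : ∃ p, a = v.1.lift θ + 2 * p) (hb : ∃ p, b = v.2.1.lift θ + 2 * p)
    (hc : ∃ p, c = v.2.2.1.lift θ + 2 * p) (hd : ∃ p, d = v.2.2.2.lift θ + 2 * p) :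
    v.half θ ∈ P := by
  obtain ⟨p, rfl⟩ := ha
  obtain ⟨q, rfl⟩ := hb
  obtain ⟨r, rfl⟩ := hc
  obtain ⟨s, rfl⟩ := hd
  convert hP.add_int_mem h (-p) (-q) (-r) (-s) using 1
  ext <;> simp [ResidueVec.half, algebraMap_two] <;> ring

theorem mem_of_half_mem {v : ResidueVec} (h : v.half θ ∈ P) {a b c d : 𝓞 F}
    (ha : ∃ p, a = v.1.lift θ + 2 * p) (hb : ∃ p, b = v.2.1.lift θ + 2 * p)
    (hc : ∃ p, c = v.2.2.1.lift θ + 2 * p) (hd : ∃ p, d = v.2.2.2.lift θ + 2 * p) :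
    (⟨cc a / 2, cc b / 2, cc c / 2, cc d / 2⟩ : ℍ[F, -1, -1]) ∈ P := by
  obtain ⟨p, rfl⟩ := ha
  obtain ⟨q, rfl⟩ := hb
  obtain ⟨r, rfl⟩ := hc
  obtain ⟨s, rfl⟩ := hd
  convert hP.add_int_mem h p q r s using 1
  ext <;> simp [algebraMap_two] <;> ring

theorem half_add_mem {v w : ResidueVec} (hv : v.half θ ∈ P) (hw : w.half θ ∈ P) :
    (v.add w).half θ ∈ P := by
  refine hP.half_mem (a := v.1.lift θ + w.1.lift θ) (b := v.2.1.lift θ + w.2.1.lift θ)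
    (c := v.2.2.1.lift θ + w.2.2.1.lift θ) (d := v.2.2.2.lift θ + w.2.2.2.lift θ) ?_
    (Residue.exists_lift_add _ _ _) (Residue.exists_lift_add _ _ _)
    (Residue.exists_lift_add _ _ _) (Residue.exists_lift_add _ _ _)
  convert P.add_mem hv hw using 1
  ext <;> simp [ResidueVec.half] <;> ring

theorem half_theta_mem {e : Bool} {D : ℕ} (hθ : θ ^ 2 = e.toNat * θ + D) {v : ResidueVec}
    (hv : v.half θ ∈ P) : (v.theta e D.bodd).half θ ∈ P := by
  refine hP.half_mem (a := θ * v.1.lift θ) (b := θ * v.2.1.lift θ) (c := θ * v.2.2.1.lift θ)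
    (d := θ * v.2.2.2.lift θ) ?_ (Residue.exists_theta_mul_lift hθ _)
    (Residue.exists_theta_mul_lift hθ _) (Residue.exists_theta_mul_lift hθ _)
    (Residue.exists_theta_mul_lift hθ _)
  convert hP.smul_mem θ hv using 1
  ext <;> simp <;> ring

theorem half_mulI_mem {v : ResidueVec} (hv : v.half θ ∈ P) : v.mulI.half θ ∈ P := by
  refine hP.half_mem (a := -v.2.1.lift θ) (b := v.1.lift θ) (c := -v.2.2.2.lift θ)
    (d := v.2.2.1.lift θ) ?_ ⟨-v.2.1.lift θ, ?_⟩ ⟨0, ?_⟩ ⟨-v.2.2.2.lift θ, ?_⟩ ⟨0, ?_⟩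
  · convert hP.i_mul_mem hv using 1
    ext <;> simp <;> ring
  all_goals simp only [ResidueVec.mulI]; ring

theorem half_mulJ_mem {v : ResidueVec} (hv : v.half θ ∈ P) : v.mulJ.half θ ∈ P := by
  refine hP.half_mem (a := -v.2.2.1.lift θ) (b := v.2.2.2.lift θ) (c := v.1.lift θ)
    (d := -v.2.1.lift θ) ?_ ⟨-v.2.2.1.lift θ, ?_⟩ ⟨0, ?_⟩ ⟨0, ?_⟩ ⟨-v.2.1.lift θ, ?_⟩
  · convert hP.j_mul_mem hv using 1
    ext <;> simp <;> ring
  all_goals simp only [ResidueVec.mulJ]; ring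

theorem isValid {e : Bool} {D : ℕ} (hθ : θ ^ 2 = e.toNat * θ + D)
    (hb : ∀ a : 𝓞 F, ∃ m n : ℤ, a = m + n * θ)
    (hi : ∀ m n : ℤ, (m + n * θ : 𝓞 F) = 0 → m = 0 ∧ n = 0) {v : ResidueVec}
    (hv : v.half θ ∈ P) : v.IsValid e (D % 4) := by
  obtain ⟨a, b, c, d, N, h, hN⟩ := hP.exists_half _ hv
  have hinj : ∀ {x y : 𝓞 F}, cc x / 2 = cc y / 2 → x = y := fun h =>
    RingOfIntegers.coe_injective ((div_left_inj' two_ne_zero).1 h)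
  have ha := hinj (congrArg QuaternionAlgebra.re h)
  have hb' := hinj (congrArg QuaternionAlgebra.imI h)
  have hc := hinj (congrArg QuaternionAlgebra.imJ h)
  have hd := hinj (congrArg QuaternionAlgebra.imK h)
  obtain ⟨m, n, rfl⟩ := hb N
  obtain ⟨⟨a0, a1⟩, ⟨b0, b1⟩, ⟨c0, c1⟩, ⟨d0, d1⟩⟩ := v
  subst ha hb' hc hd
  have hsq : ∀ b : Bool, ((b.toNat : ℤ)) ^ 2 = b.toNat := by decide
  have hand : ∀ a b : Bool, (((a && b).toNat : ℤ)) = a.toNat * b.toNat := by decide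
  have := hi ((a0.toNat : ℤ) ^ 2 + (b0.toNat : ℤ) ^ 2 + (c0.toNat : ℤ) ^ 2 + (d0.toNat : ℤ) ^ 2
      + D * ((a1.toNat : ℤ) ^ 2 + (b1.toNat : ℤ) ^ 2 + (c1.toNat : ℤ) ^ 2 + (d1.toNat : ℤ) ^ 2)
        - 4 * m)
    (e.toNat * ((a1.toNat : ℤ) ^ 2 + (b1.toNat : ℤ) ^ 2 + (c1.toNat : ℤ) ^ 2 + (d1.toNat : ℤ) ^ 2)
      + 2 * ((a0.toNat : ℤ) * a1.toNat + (b0.toNat : ℤ) * b1.toNat + (c0.toNat : ℤ) * c1.toNat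
        + (d0.toNat : ℤ) * d1.toNat) - 4 * n) (by
    simp only [Residue.lift] at hN
    push_cast
    linear_combination hN - ((a1.toNat : 𝓞 F) ^ 2 + (b1.toNat : 𝓞 F) ^ 2 + (c1.toNat : 𝓞 F) ^ 2
      + (d1.toNat : 𝓞 F) ^ 2) * hθ)
  simp only [hsq, ← hand] at this
  obtain ⟨h1, h2⟩ := this
  constructor
  · have h3 : (D : ℤ) = (D % 4 : ℕ) + 4 * (D / 4 : ℕ) := by omega
    rw [h3] at h1
    generalize ha : a1.toNat + b1.toNat + c1.toNat + d1.toNat = s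
    have ha' : (a1.toNat : ℤ) + b1.toNat + c1.toNat + d1.toNat = s := by exact_mod_cast ha
    rw [ha'] at h1
    dsimp only
    generalize D % 4 = r at *
    have h4 : ((D / 4 : ℕ) : ℤ) * s = ((D / 4 * s : ℕ) : ℤ) := by push_cast; rfl
    have h5 : ((r : ℕ) : ℤ) * s = ((r * s : ℕ) : ℤ) := by push_cast; rfl
    rw [add_mul, mul_assoc, h4, h5] at h1
    omega
  · cases e <;> simp only [Bool.toNat_true, Bool.toNat_false] at h2 ⊢ <;> omega

end IsHalfIntegral

namespace ResidueVec

/-- The diagonal vector, the residue of `a (1 + i + j + k)`. -/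
def diag (a : Residue) : ResidueVec := (a, a, a, a)

def mulIJ (i j : Bool) (v : ResidueVec) : ResidueVec :=
  bif i then bif j then v.mulI.mulJ else v.mulI else bif j then v.mulJ else v

/-- The image of the residue `(m, n)` modulo the ramified prime above `2`. -/
def kind (κ : Bool) (a : Residue) : Bool := a.1 ^^ (κ && a.2)

def IsHurwitz (κ : Bool) (v : ResidueVec) : Prop :=
  kind κ v.2.1 = kind κ v.1 ∧ kind κ v.2.2.1 = kind κ v.1 ∧ kind κ v.2.2.2 = kind κ v.1

instance (κ : Bool) (v : ResidueVec) : Decidable (IsHurwitz κ v) :=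
  inferInstanceAs (Decidable (_ ∧ _))

/-- The residue of `u + i + v j` and of its images under the cyclic permutations of `i, j, k`. -/
def IsSplit (u v : Residue) (x : ResidueVec) : Prop :=
  x = (u, (true, false), v, (false, false)) ∨ x = (u, (false, false), (true, false), v) ∨
    x = (u, v, (false, false), (true, false))

instance (u v : Residue) (x : ResidueVec) : Decidable (IsSplit u v x) :=
  inferInstanceAs (Decidable (_ ∨ _))

set_option maxRecDepth 100000 in
theorem isHurwitz_or_isSplit_two : ∀ v : ResidueVec, v.IsValid false 2 → v.IsHurwitz false ∨
    ∃ α i j : Bool, IsSplit (true, false) (false, true) (bif α then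
      (v.mulIJ i j).add ((v.mulIJ i j).theta false false) else v.mulIJ i j) := by
  rintro ⟨⟨a0, a1⟩, ⟨b0, b1⟩, ⟨c0, c1⟩, ⟨d0, d1⟩⟩
  revert a0 a1 b0 b1 c0 c1 d0 d1
  decide

set_option maxRecDepth 100000 in
theorem isHurwitz_or_isSplit_three : ∀ v : ResidueVec, v.IsValid false 3 → v.IsHurwitz true ∨
    ∃ i j : Bool, IsSplit (false, true) (false, false) (v.mulIJ i j) ∨ ∃ i' j',
      IsSplit (false, true) (false, false) ((v.mulIJ i j).add
        ((v.mulIJ i' j').add ((v.mulIJ i' j').theta false true))) := by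
  rintro ⟨⟨a0, a1⟩, ⟨b0, b1⟩, ⟨c0, c1⟩, ⟨d0, d1⟩⟩
  revert a0 a1 b0 b1 c0 c1 d0 d1
  decide

set_option maxRecDepth 100000 in
theorem IsHurwitz.eq_add : ∀ κ : Bool, ∀ v : ResidueVec,
    v.IsValid false (2 + κ.toNat) → v.IsHurwitz κ → ∃ β γ : Bool,
      v = (diag v.1).add (((false, false), (κ && β, β), (κ && γ, γ), (κ && (β ^^ γ), β ^^ γ))) := by
  rintro κ ⟨⟨a0, a1⟩, ⟨b0, b1⟩, ⟨c0, c1⟩, ⟨d0, d1⟩⟩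
  revert κ a0 a1 b0 b1 c0 c1 d0 d1
  decide

/-- The product of `x` with `1`, `θ` or `1 + θ` is the residue of `1 + i + j + k`. -/
def IsMultipleDiag (D : Bool) (x : ResidueVec) : Prop :=
  x = diag (true, false) ∨ x.theta true D = diag (true, false) ∨
    x.add (x.theta true D) = diag (true, false)

instance (D : Bool) (x : ResidueVec) : Decidable (IsMultipleDiag D x) :=
  inferInstanceAs (Decidable (_ ∨ _))

set_option maxRecDepth 100000 in
theorem eq_diag_or_isMultipleDiag (D : ℕ) (hD : D < 4) (v : ResidueVec) (hv : v.IsValid true D) :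
    v = diag v.1 ∨ ∃ i j : Bool, IsMultipleDiag D.bodd (v.add (v.mulIJ i j)) := by
  revert hv
  obtain ⟨⟨a0, a1⟩, ⟨b0, b1⟩, ⟨c0, c1⟩, ⟨d0, d1⟩⟩ := v
  interval_cases D <;> revert a0 a1 b0 b1 c0 c1 d0 d1 <;> decide

end ResidueVec

/-- The automorphism `i ↦ j ↦ k ↦ i` of `(-1,-1/F)`. -/
def cyclicAut : ℍ[F, -1, -1] ≃ₐ[F] ℍ[F, -1, -1] where
  toFun x := ⟨x.re, x.imK, x.imI, x.imJ⟩
  invFun x := ⟨x.re, x.imJ, x.imK, x.imI⟩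
  left_inv _ := rfl
  right_inv _ := rfl
  map_mul' x y := by ext <;> simp <;> ring
  map_add' x y := by ext <;> simp
  commutes' r := by ext <;> simp

namespace IsHalfIntegral

variable {P : Subring ℍ[F, -1, -1]} (hP : IsHalfIntegral P) {θ : 𝓞 F}
include hP

theorem comap_cyclicAut :
    IsHalfIntegral (P.comap (cyclicAut (F := F) : ℍ[F, -1, -1] →+* ℍ[F, -1, -1])) := by
  refine ⟨fun r => ?_, ?_, ?_, ?_⟩
  · rw [Subring.mem_comap, RingHom.coe_coe, AlgEquiv.commutes]
    exact hP.scalar_mem r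
  · exact hP.j_mem
  · rw [Subring.mem_comap]
    convert P.mul_mem hP.i_mem hP.j_mem using 1
    ext <;> simp [cyclicAut]
  · intro x hx
    obtain ⟨a, b, c, d, N, h, hN⟩ := hP.exists_half _ (Subring.mem_comap.1 hx)
    refine ⟨a, c, d, b, N, ?_, by rw [← hN]; ring⟩
    ext
    · exact (congrArg QuaternionAlgebra.re h :)
    · exact (congrArg QuaternionAlgebra.imJ h :)
    · exact (congrArg QuaternionAlgebra.imK h :)
    · exact (congrArg QuaternionAlgebra.imI h :)

theorem half_mulIJ_mem {v : ResidueVec} (hv : v.half θ ∈ P) (i j : Bool) :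
    (v.mulIJ i j).half θ ∈ P := by
  cases i <;> cases j
  · exact hv
  · exact hP.half_mulJ_mem hv
  · exact hP.half_mulI_mem hv
  · exact hP.half_mulJ_mem (hP.half_mulI_mem hv)

theorem exists_residueVec (hb : ∀ a : 𝓞 F, ∃ m n : ℤ, a = m + n * θ) {x : ℍ[F, -1, -1]}
    (hx : x ∈ P) : ∃ v : ResidueVec, v.half θ ∈ P ∧
      ∀ P' : Subring ℍ[F, -1, -1], IsHalfIntegral P' → v.half θ ∈ P' → x ∈ P' := by
  obtain ⟨a, b, c, d, N, rfl, hN⟩ := hP.exists_half x hx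
  obtain ⟨ra, ha⟩ := Residue.exists_eq_lift_add hb a
  obtain ⟨rb, hb'⟩ := Residue.exists_eq_lift_add hb b
  obtain ⟨rc, hc⟩ := Residue.exists_eq_lift_add hb c
  obtain ⟨rd, hd⟩ := Residue.exists_eq_lift_add hb d
  exact ⟨(ra, rb, rc, rd), hP.half_mem hx ha hb' hc hd,
    fun P' hP' h => hP'.mem_of_half_mem h ha hb' hc hd⟩

omit hP in
theorem _root_.QuatPaper.half_diag_mem_hurwitzOrder {π m : 𝓞 F} (h : π ^ 2 = 2 * m) (a : Residue) :
    (ResidueVec.diag a).half θ ∈ hurwitzOrder F π m h := by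
  convert (hurwitzOrder_isHalfIntegral h).smul_mem (a.lift θ) (mem_hurwitzOrder h) using 1
  ext <;> simp [ResidueVec.half, ResidueVec.diag, div_eq_mul_inv]

theorem le_hurwitzOrder_of_isHurwitz {D : ℕ} {κ : Bool} (hD : D % 4 = 2 + κ.toNat)
    (hθ : θ ^ 2 = D) (hb : ∀ a : 𝓞 F, ∃ m n : ℤ, a = m + n * θ)
    (hi : ∀ m n : ℤ, (m + n * θ : 𝓞 F) = 0 → m = 0 ∧ n = 0) {m : 𝓞 F}
    (h : (κ.toNat + θ) ^ 2 = 2 * m)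
    (hH : ∀ v : ResidueVec, v.half θ ∈ P → v.IsHurwitz κ) :
    P ≤ hurwitzOrder F (κ.toNat + θ) m h := by
  intro x hx
  obtain ⟨v, hv, hx'⟩ := hP.exists_residueVec hb hx
  have hh := hurwitzOrder_isHalfIntegral h
  refine hx' _ hh ?_
  have hval := hP.isValid (e := false) (by simpa using hθ) hb hi hv
  rw [hD] at hval
  obtain ⟨β, γ, hv'⟩ := ResidueVec.IsHurwitz.eq_add κ v hval (hH v hv)
  rw [hv']
  refine hh.half_add_mem (half_diag_mem_hurwitzOrder h _) ?_
  refine ⟨0, 0, 0, (β || γ).toNat * (κ.toNat + θ), β.toNat, γ.toNat, ?_⟩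
  cases κ <;> cases β <;> cases γ <;> ext <;> simp [ResidueVec.half, Residue.lift] <;> ring

theorem exists_isSplit {D : ℕ} {κ : Bool} (hD : D % 4 = 2 + κ.toNat)
    (hθ : θ ^ 2 = D) (hb : ∀ a : 𝓞 F, ∃ m n : ℤ, a = m + n * θ)
    (hi : ∀ m n : ℤ, (m + n * θ : 𝓞 F) = 0 → m = 0 ∧ n = 0)
    (hH : ¬ ∀ v : ResidueVec, v.half θ ∈ P → v.IsHurwitz κ) :
    ∃ x : ResidueVec, x.half θ ∈ P ∧ x.IsSplit (!κ, κ) (false, !κ) := by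
  push Not at hH
  obtain ⟨v, hv, hvH⟩ := hH
  have hθ' : θ ^ 2 = (false.toNat : 𝓞 F) * θ + D := by simpa using hθ
  have hval := hP.isValid hθ' hb hi hv
  rw [hD] at hval
  have hbodd : D.bodd = κ := by
    rw [← Nat.div_add_mod D 4, hD]
    cases κ <;> simp [Nat.bodd_mul]
  have hth : ∀ {w : ResidueVec}, w.half θ ∈ P → (w.theta false κ).half θ ∈ P := by
    intro w hw
    rw [← hbodd]
    exact hP.half_theta_mem hθ' hw
  cases κ
  · obtain h | ⟨α, i, j, h⟩ := ResidueVec.isHurwitz_or_isSplit_two v hval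
    · exact absurd h hvH
    refine ⟨_, ?_, h⟩
    have hw := hP.half_mulIJ_mem hv i j
    cases α
    · exact hw
    · exact hP.half_add_mem hw (hth hw)
  · obtain h | ⟨i, j, h | ⟨i', j', h⟩⟩ := ResidueVec.isHurwitz_or_isSplit_three v hval
    · exact absurd h hvH
    · exact ⟨_, hP.half_mulIJ_mem hv i j, h⟩
    · have hw := hP.half_mulIJ_mem hv i' j'
      exact ⟨_, hP.half_add_mem (hP.half_mulIJ_mem hv i j) (hP.half_add_mem hw (hth hw)), h⟩

theorem exists_comap_eq_splitOrder {r s : Residue} {w : 𝓞 F}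
    (h : r.lift θ ^ 2 + s.lift θ ^ 2 + 1 = 4 * w) {x : ResidueVec} (hx : x.half θ ∈ P)
    (hs : x.IsSplit r s) : ∃ τ : ℍ[F, -1, -1] ≃ₐ[F] ℍ[F, -1, -1],
      P.comap (τ : ℍ[F, -1, -1] →+* ℍ[F, -1, -1]) = splitOrder F (r.lift θ) (s.lift θ) w h := by
  obtain rfl | rfl | rfl := hs
  · refine ⟨.refl, hP.eq_splitOrder h ?_⟩
    convert hx using 1
    ext <;> simp [ResidueVec.half, Residue.lift]
  · refine ⟨cyclicAut, hP.comap_cyclicAut.eq_splitOrder h ?_⟩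
    rw [Subring.mem_comap]
    convert hx using 1
    ext <;> simp [ResidueVec.half, Residue.lift, cyclicAut]
  · refine ⟨cyclicAut.trans cyclicAut, hP.comap_cyclicAut.comap_cyclicAut.eq_splitOrder h ?_⟩
    rw [Subring.mem_comap, Subring.mem_comap]
    convert hx using 1
    ext <;> simp [ResidueVec.half, Residue.lift, cyclicAut]

theorem le_hurwitzOrder_or_mem {D : ℕ} (hθ : θ ^ 2 = θ + D)
    (hb : ∀ a : 𝓞 F, ∃ m n : ℤ, a = m + n * θ)
    (hi : ∀ m n : ℤ, (m + n * θ : 𝓞 F) = 0 → m = 0 ∧ n = 0) :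
    P ≤ hurwitzOrder F 0 0 (by ring) ∨ (⟨1 / 2, 1 / 2, 1 / 2, 1 / 2⟩ : ℍ[F, -1, -1]) ∈ P := by
  by_cases hH : ∀ v : ResidueVec, v.half θ ∈ P → v = .diag v.1
  · left
    intro x hx
    obtain ⟨v, hv, hx'⟩ := hP.exists_residueVec hb hx
    refine hx' _ (hurwitzOrder_isHalfIntegral _) ?_
    rw [hH v hv]
    exact half_diag_mem_hurwitzOrder _ _
  · right
    push Not at hH
    obtain ⟨v, hv, hvH⟩ := hH
    have hθ' : θ ^ 2 = (true.toNat : 𝓞 F) * θ + D := by simpa using hθ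
    have hbodd : (D % 4).bodd = D.bodd := by
      conv_rhs => rw [← Nat.div_add_mod D 4]
      simp [Nat.bodd_mul]
    have hd : (ResidueVec.diag (true, false)).half θ ∈ P := by
      obtain h | ⟨i, j, h⟩ := ResidueVec.eq_diag_or_isMultipleDiag (D % 4)
        (Nat.mod_lt _ (by norm_num))
        v (hP.isValid hθ' hb hi hv)
      · exact absurd h hvH
      rw [hbodd] at h
      have hw := hP.half_add_mem hv (hP.half_mulIJ_mem hv i j)
      obtain h | h | h := h <;> rw [← h]
      · exact hw
      · exact hP.half_theta_mem hθ' hw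
      · exact hP.half_add_mem hw (hP.half_theta_mem hθ' hw)
    convert hd using 1
    ext <;> simp [ResidueVec.half, Residue.lift, ResidueVec.diag]

end IsHalfIntegral

section Norm

variable {A B : F}

theorem mul_star_eq (x : ℍ[F, A, B]) : x * star x = algebraMap F _ (redNorm F x) := by
  ext <;> simp [redNorm] <;> ring

theorem redNorm_eq (x : ℍ[F, A, B]) :
    redNorm F x = x.re ^ 2 - A * x.imI ^ 2 - B * x.imJ ^ 2 + A * B * x.imK ^ 2 := by
  simp [redNorm]
  ring

theorem redNorm_mul (x y : ℍ[F, A, B]) : redNorm F (x * y) = redNorm F x * redNorm F y := by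
  simp [redNorm_eq]
  ring

theorem redNorm_algebraMap (r : F) : redNorm F (algebraMap F ℍ[F, A, B] r) = r ^ 2 := by
  simp [redNorm_eq]

theorem mul_self_eq (x : ℍ[F, A, B]) :
    x * x = algebraMap F _ (2 * x.re) * x - algebraMap F _ (redNorm F x) := by
  ext <;> simp [redNorm_eq, QuaternionAlgebra.algebraMap_eq] <;> ring

theorem mul_self_eq_neg_one {x : ℍ[F, A, B]} (h1 : redNorm F x = 1) {r : F}
    (h2 : x * x = algebraMap F _ r) (h3 : x ≠ 1) (h4 : x ≠ -1) : x * x = -1 := by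
  by_cases hre : x.re = 0
  · rw [mul_self_eq, hre, h1]
    simp
  exfalso
  rw [mul_self_eq, QuaternionAlgebra.algebraMap_eq, QuaternionAlgebra.algebraMap_eq,
    QuaternionAlgebra.algebraMap_eq] at h2
  have hI := congrArg QuaternionAlgebra.imI h2
  have hJ := congrArg QuaternionAlgebra.imJ h2
  have hK := congrArg QuaternionAlgebra.imK h2
  simp [hre] at hI hJ hK
  rw [redNorm_eq, hI, hJ, hK] at h1
  have : (x.re - 1) * (x.re + 1) = 0 := by linear_combination h1
  rcases mul_eq_zero.1 this with h | h
  · apply h3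
    ext <;> simp [hI, hJ, hK]
    linear_combination h
  · apply h4
    ext <;> simp [hI, hJ, hK]
    linear_combination h

variable {σ₀ : F →+* ℝ} (hA : σ₀ A < 0) (hB : σ₀ B < 0)
include hA hB

theorem redNorm_pos {x : ℍ[F, A, B]} (hx : x ≠ 0) : 0 < σ₀ (redNorm F x) := by
  have h : σ₀ (redNorm F x) = σ₀ x.re ^ 2 + (-σ₀ A) * σ₀ x.imI ^ 2 + (-σ₀ B) * σ₀ x.imJ ^ 2
      + (σ₀ A * σ₀ B) * σ₀ x.imK ^ 2 := by
    rw [redNorm_eq]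
    simp
    ring
  rw [h]
  have h1 := sq_nonneg (σ₀ x.re)
  have h2 := mul_nonneg (neg_pos.2 hA).le (sq_nonneg (σ₀ x.imI))
  have h3 := mul_nonneg (neg_pos.2 hB).le (sq_nonneg (σ₀ x.imJ))
  have h4 := mul_nonneg (mul_pos_of_neg_of_neg hA hB).le (sq_nonneg (σ₀ x.imK))
  by_contra hle
  apply hx
  have e1 : σ₀ x.re = 0 := by
    have : σ₀ x.re ^ 2 = 0 := by linarith
    simpa using this
  have e2 : σ₀ x.imI = 0 := by
    have : (-σ₀ A) * σ₀ x.imI ^ 2 = 0 := by linarith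
    simpa [hA.ne] using this
  have e3 : σ₀ x.imJ = 0 := by
    have : (-σ₀ B) * σ₀ x.imJ ^ 2 = 0 := by linarith
    simpa [hB.ne] using this
  have e4 : σ₀ x.imK = 0 := by
    have : (σ₀ A * σ₀ B) * σ₀ x.imK ^ 2 = 0 := by linarith
    simpa [hA.ne, hB.ne] using this
  rw [map_eq_zero] at e1 e2 e3 e4
  ext <;> simp [*]

theorem isUnit_of_ne_zero {x : ℍ[F, A, B]} (hx : x ≠ 0) : IsUnit x := by
  have hn : redNorm F x ≠ 0 := fun h => by simpa [h] using redNorm_pos hA hB hx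
  have h1 : x * (star x * algebraMap F _ (redNorm F x)⁻¹) = 1 := by
    rw [← mul_assoc, mul_star_eq, ← map_mul, mul_inv_cancel₀ hn, map_one]
  have h2 : (star x * algebraMap F _ (redNorm F x)⁻¹) * x = 1 := by
    rw [mul_assoc, Algebra.commutes, ← mul_assoc]
    have : star x * x = x * star x := by ext <;> simp <;> ring
    rw [this, mul_star_eq, ← map_mul, mul_inv_cancel₀ hn, map_one]
  exact ⟨⟨x, _, h1, h2⟩, rfl⟩

end Norm

theorem IsOrder.exists_redNorm_eq {A B : F} {O : Subring ℍ[F, A, B]} (hO : IsOrder F O)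
    (u : Oˣ) : ∃ n : (𝓞 F)ˣ, redNorm F ((u : O) : ℍ[F, A, B]) = cc ↑n := by
  have hint : ∀ x : O, ∃ n : 𝓞 F, cc n = redNorm F (x : ℍ[F, A, B]) := fun x =>
    exists_ringOfIntegers (isIntegral_two_re_and_norm (isIntegral_of_mem_fg hO.2.1 x.2)).2
  obtain ⟨m, hm⟩ := hint u
  obtain ⟨n, hn⟩ := hint ↑u⁻¹
  have hmn : m * n = 1 := by
    apply RingOfIntegers.coe_injective
    rw [map_mul, hm, hn, ← redNorm_mul, ← Subring.coe_mul, Units.mul_inv]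
    simp [redNorm]
  exact ⟨Units.mkOfMulEqOne m n hmn, hm.symm⟩

section Extraction

variable {A B : F} {O : Subring ℍ[F, A, B]} (hO : IsOrder F O)

theorem exists_mul_self_eq_algebraMap {φ : Oˣ →* DihedralGroup 2}
    (hφ : ∀ u, φ u = 1 ↔ IsScalarUnit F u) (u : Oˣ) :
    ∃ r : F, ((u : O) : ℍ[F, A, B]) * (u : O) = algebraMap F _ r := by
  have h : ∀ g : DihedralGroup 2, g * g = 1 := by decide
  obtain ⟨r, hr⟩ := (hφ (u * u)).1 (by rw [map_mul, h])
  exact ⟨_, by simpa using hr⟩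

include hO

theorem scale_mem_and_mul_self {φ : Oˣ →* DihedralGroup 2}
    (hφ : ∀ u, φ u = 1 ↔ IsScalarUnit F u) {u : Oˣ} (hu : φ u ≠ 1) {r : (𝓞 F)ˣ}
    (hr : redNorm F ((u : O) : ℍ[F, A, B]) = cc ↑r ^ 2) :
    algebraMap F ℍ[F, A, B] (cc ↑r⁻¹) * (u : O) ∈ O ∧
    (algebraMap F ℍ[F, A, B] (cc ↑r⁻¹) * (u : O)) *
      (algebraMap F ℍ[F, A, B] (cc ↑r⁻¹) * (u : O)) = -1 := by
  have hrr : cc ↑r⁻¹ * cc ↑r = 1 := by rw [← map_mul, Units.inv_mul, map_one]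
  have hback : ((u : O) : ℍ[F, A, B]) =
      algebraMap F _ (cc ↑r) * (algebraMap F ℍ[F, A, B] (cc ↑r⁻¹) * (u : O)) := by
    rw [← mul_assoc, ← map_mul, mul_comm, hrr, map_one, one_mul]
  refine ⟨O.mul_mem (hO.1 ⟨_, rfl⟩) (u : O).2, ?_⟩
  obtain ⟨t, ht⟩ := exists_mul_self_eq_algebraMap hφ u
  refine mul_self_eq_neg_one ?_ (r := cc ↑r⁻¹ * cc ↑r⁻¹ * t) ?_ (fun h => hu ?_) (fun h => hu ?_)
  · rw [redNorm_mul, redNorm_algebraMap, hr, ← mul_pow, hrr, one_pow]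
  · rw [map_mul, ← ht, map_mul, (Algebra.commute_algebraMap_right _ _).mul_mul_mul_comm]
  · rw [h, mul_one] at hback
    exact (hφ u).2 ⟨r, hback⟩
  · rw [h] at hback
    exact (hφ u).2 ⟨-r, by rw [hback]; simp⟩

theorem RedUnitDihedralFirstKind.exists_generators (h : RedUnitDihedralFirstKind F 2 O) :
    (∃ i ∈ O, ∃ j ∈ O, i * i = -1 ∧ j * j = -1 ∧ j * i = -(i * j)) ∧
    ∀ u : Oˣ, ∃ r : F, ((u : O) : ℍ[F, A, B]) * (u : O) = algebraMap F _ r := by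
  obtain ⟨φ, hs, hφ, hN⟩ := h
  refine ⟨?_, exists_mul_self_eq_algebraMap hφ⟩
  have key : ∀ g : DihedralGroup 2, g ≠ 1 → ∃ u : Oˣ, φ u = g ∧ ∃ r : (𝓞 F)ˣ,
      redNorm F ((u : O) : ℍ[F, A, B]) = cc ↑r ^ 2 := by
    have hg2 : ∀ g : DihedralGroup 2, g * g = 1 := by decide
    intro g hg
    obtain ⟨u, rfl⟩ := hs g
    exact hN u hg (hg2 _)
  obtain ⟨u, hu, r, hr⟩ := key (.r 1) (by decide)
  obtain ⟨v, hv, s, hs⟩ := key (.sr 0) (by decide)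
  obtain ⟨hi, hii⟩ := scale_mem_and_mul_self hO hφ (by rw [hu]; decide) hr
  obtain ⟨hj, hjj⟩ := scale_mem_and_mul_self hO hφ (by rw [hv]; decide) hs
  obtain ⟨-, hk⟩ := scale_mem_and_mul_self hO hφ (u := u * v) (r := r * s)
    (by rw [map_mul, hu, hv]; decide) (by
      rw [Units.val_mul, Subring.coe_mul, redNorm_mul, hr, hs]; simp; ring)
  refine ⟨_, hi, _, hj, hii, hjj, ?_⟩
  have hij : algebraMap F ℍ[F, A, B] (cc ↑(r * s)⁻¹) * ((u * v : Oˣ) : O) =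
      (algebraMap F ℍ[F, A, B] (cc ↑r⁻¹) * (u : O)) *
          (algebraMap F ℍ[F, A, B] (cc ↑s⁻¹) * (v : O)) := by
    rw [mul_inv, Units.val_mul, Units.val_mul, map_mul, map_mul, Subring.coe_mul, mul_assoc,
      mul_assoc, ← mul_assoc _ ((u : O) : ℍ[F, A, B]), Algebra.commutes (cc ↑s⁻¹)]
    simp only [mul_assoc]
  rw [hij] at hk
  generalize algebraMap F ℍ[F, A, B] (cc ↑r⁻¹) * (u : O) = i at *
  generalize algebraMap F ℍ[F, A, B] (cc ↑s⁻¹) * (v : O) = j at *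
  calc j * i = (i * i) * (j * i) * (j * j) := by rw [hii, hjj]; noncomm_ring
    _ = i * (i * j * (i * j)) * j := by noncomm_ring
    _ = -(i * j) := by rw [hk]; noncomm_ring

end Extraction

section Transport

variable {H H' : Type} [Ring H] [Algebra F H] [Ring H'] [Algebra F H']

theorem IsOrder.comap_algEquiv {O : Subring H'} (hO : IsOrder F O) (e : H ≃ₐ[F] H') :
    IsOrder F (O.comap (e : H →+* H')) := by
  have himg : (O.comap (e : H →+* H') : Set H) = e.symm '' O := by
    ext x
    constructor
    · intro hx
      exact ⟨e x, hx, e.symm_apply_apply x⟩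
    · rintro ⟨y, hy, rfl⟩
      simpa using hy
  refine ⟨?_, ?_, ?_⟩
  · rintro _ ⟨r, rfl⟩
    simpa using hO.1 ⟨r, rfl⟩
  · obtain ⟨S, hS⟩ := (AddSubgroup.fg_iff _).1 hO.2.1
    refine (AddSubgroup.fg_iff _).2 ⟨e.symm '' S, ?_, hS.2.image _⟩
    apply SetLike.coe_injective
    have h := AddMonoidHom.map_closure (e.symm : H' →+* H).toAddMonoidHom S
    rw [hS.1] at h
    exact (congrArg SetLike.coe h.symm).trans himg.symm
  · have h := congrArg (Submodule.map e.symm.toLinearMap) hO.2.2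
    rw [Submodule.map_span, Submodule.map_top, LinearMap.range_eq_top.2 e.symm.surjective] at h
    rw [himg]
    exact h

theorem IsMaximalOrder.comap_algEquiv {O : Subring H'} (hO : IsMaximalOrder F O)
    (e : H ≃ₐ[F] H') : IsMaximalOrder F (O.comap (e : H →+* H')) := by
  refine ⟨hO.1.comap_algEquiv e, fun O' hO' hle => le_antisymm (fun x hx => ?_) hle⟩
  have h1 := hO.2 (O'.comap (e.symm : H' →+* H)) (hO'.comap_algEquiv e.symm) (fun y hy => by
    apply hle
    simpa using hy)
  rw [Subring.mem_comap, ← h1]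
  simpa using hx

end Transport

section Generators

variable {A B : F}

/-- Anticommuting square roots of `-1` in a totally definite quaternion algebra `H` identify it
with `(-1,-1/F)`. -/
theorem exists_algEquiv_of_generators {σ₀ : F →+* ℝ} {i j : ℍ[F, A, B]} (hi : i * i = -1)
    (hj : j * j = -1) (hij : j * i = -(i * j)) :
    ∃ e : ℍ[F, -1, -1] ≃ₐ[F] ℍ[F, A, B], e ⟨0, 1, 0, 0⟩ = i ∧ e ⟨0, 0, 1, 0⟩ = j := by
  let b : QuaternionAlgebra.Basis ℍ[F, A, B] (-1 : F) 0 (-1) :=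
    { i := i, j := j, k := i * j
      i_mul_i := by simp [hi]
      j_mul_j := by simp [hj]
      i_mul_j := rfl
      j_mul_i := by simp [hij] }
  have hinj : Function.Injective b.liftHom := by
    rw [injective_iff_map_eq_zero]
    intro x hx
    by_contra hne
    have h1 : σ₀ (-1) < 0 := by simp
    obtain ⟨u, rfl⟩ := isUnit_of_ne_zero h1 h1 hne
    have := (u.isUnit.map b.liftHom)
    rw [hx] at this
    exact not_isUnit_zero this
  have hbij := (LinearMap.injective_iff_surjective_of_finrank_eq_finrank
    (f := b.liftHom.toLinearMap) (by rw [QuaternionAlgebra.finrank_eq_four,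
      QuaternionAlgebra.finrank_eq_four])).1 hinj
  refine ⟨AlgEquiv.ofBijective b.liftHom ⟨hinj, hbij⟩, ?_, ?_⟩
  · change b.lift _ = i
    simp [QuaternionAlgebra.Basis.lift, b]
  · change b.lift _ = j
    simp [QuaternionAlgebra.Basis.lift, b]

end Generators

/-- The squares of the units of `O` are scalars. -/
def HasScalarSquares {H : Type} [Ring H] [Algebra F H] (O : Subring H) : Prop :=
  ∀ x ∈ O, ∀ y ∈ O, x * y = 1 → y * x = 1 → ∃ r : F, x * x = algebraMap F H r

theorem hasScalarSquares_of_units {H : Type} [Ring H] [Algebra F H] {O : Subring H}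
    (h : ∀ u : Oˣ, ∃ r : F, ((u : O) : H) * (u : O) = algebraMap F H r) :
    HasScalarSquares (F := F) O :=
  fun x hx y hy hxy hyx => h ⟨⟨x, hx⟩, ⟨y, hy⟩, Subtype.ext hxy, Subtype.ext hyx⟩

theorem HasScalarSquares.comap_algEquiv {H H' : Type} [Ring H] [Algebra F H] [Ring H']
    [Algebra F H'] {O : Subring H'} (hO : HasScalarSquares (F := F) O) (e : H ≃ₐ[F] H') :
    HasScalarSquares (F := F) (O.comap (e : H →+* H')) := by
  intro x hx y hy hxy hyx
  obtain ⟨r, hr⟩ := hO (e x) hx (e y) hy (by rw [← map_mul, hxy, map_one])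
    (by rw [← map_mul, hyx, map_one])
  refine ⟨r, e.injective ?_⟩
  rw [map_mul, hr, e.commutes]

theorem HasScalarSquares.half_notMem {P : Subring ℍ[F, -1, -1]}
    (hP : HasScalarSquares (F := F) P) : (⟨1 / 2, 1 / 2, 1 / 2, 1 / 2⟩ : ℍ[F, -1, -1]) ∉ P := by
  intro hω
  obtain ⟨r, hr⟩ := hP _ hω _ (P.sub_mem P.one_mem hω) (by ext <;> simp <;> ring)
    (by ext <;> simp <;> ring)
  have := congrArg QuaternionAlgebra.imI hr
  norm_num at this

theorem HasScalarSquares.not_le_hurwitzOrder {P : Subring ℍ[F, -1, -1]}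
    (hP : HasScalarSquares (F := F) P) (hmax : IsMaximalOrder F P) {p m : 𝓞 F}
    (h : p ^ 2 = 2 * m) : ¬ P ≤ hurwitzOrder F p m h := by
  intro hle
  apply hP.half_notMem
  rw [← hmax.2 _ (hurwitzOrder_isHalfIntegral h).isOrder hle]
  exact mem_hurwitzOrder h

section Classification

variable {P : Subring ℍ[F, -1, -1]} (hP : HasScalarSquares (F := F) P) (hmax : IsMaximalOrder F P)
  (hi : (⟨0, 1, 0, 0⟩ : ℍ[F, -1, -1]) ∈ P) (hj : (⟨0, 0, 1, 0⟩ : ℍ[F, -1, -1]) ∈ P) {θ : 𝓞 F}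
include hP hmax hi hj

theorem HasScalarSquares.false_of_unramified {D : ℕ} (hθ : θ ^ 2 = θ + D)
    (hb : ∀ a : 𝓞 F, ∃ m n : ℤ, a = m + n * θ)
    (hz : ∀ m n : ℤ, (m + n * θ : 𝓞 F) = 0 → m = 0 ∧ n = 0) : False := by
  obtain h | h := (hmax.1.isHalfIntegral hi hj).le_hurwitzOrder_or_mem hθ hb hz
  · exact hP.not_le_hurwitzOrder hmax _ h
  · exact hP.half_notMem h

theorem HasScalarSquares.exists_comap_eq_splitOrder {D : ℕ} {κ : Bool}
    (hD : D % 4 = 2 + κ.toNat) (hθ : θ ^ 2 = D) (hb : ∀ a : 𝓞 F, ∃ m n : ℤ, a = m + n * θ)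
    (hz : ∀ m n : ℤ, (m + n * θ : 𝓞 F) = 0 → m = 0 ∧ n = 0) {w : 𝓞 F}
    (h : Residue.lift θ (!κ, κ) ^ 2 + Residue.lift θ (false, !κ) ^ 2 + 1 = 4 * w) :
    ∃ τ : ℍ[F, -1, -1] ≃ₐ[F] ℍ[F, -1, -1], P.comap (τ : ℍ[F, -1, -1] →+* ℍ[F, -1, -1]) =
      splitOrder F (Residue.lift θ (!κ, κ)) (Residue.lift θ (false, !κ)) w h := by
  have hhalf := hmax.1.isHalfIntegral hi hj
  obtain ⟨m, hm⟩ : ∃ m : 𝓞 F, (κ.toNat + θ) ^ 2 = 2 * m := by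
    have hD' : D = 2 * (D / 2) + κ.toNat := by cases κ <;> simp at hD ⊢ <;> omega
    refine ⟨(D / 2 : ℕ) + κ.toNat * (1 + θ), ?_⟩
    have h2 : (D : 𝓞 F) = 2 * (D / 2 : ℕ) + κ.toNat := by exact_mod_cast congrArg Nat.cast hD'
    rw [h2] at hθ
    cases κ <;> simp at hθ ⊢ <;> linear_combination hθ
  obtain ⟨x, hx, hs⟩ := hhalf.exists_isSplit hD hθ hb hz fun hH =>
    hP.not_le_hurwitzOrder hmax hm (hhalf.le_hurwitzOrder_of_isHurwitz hD hθ hb hz hm hH)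
  exact hhalf.exists_comap_eq_splitOrder h hx hs

end Classification

theorem exists_four_mul_eq {D : ℕ} {κ : Bool} (hD : D % 4 = 2 + κ.toNat) {θ : 𝓞 F}
    (hθ : θ ^ 2 = D) :
    ∃ w, Residue.lift θ (!κ, κ) ^ 2 + Residue.lift θ (false, !κ) ^ 2 + 1 = 4 * w := by
  have hD' : D + 2 = 4 * (D / 4 + 1) + κ.toNat := by cases κ <;> simp at hD ⊢ <;> omega
  have h2 : (D : 𝓞 F) + 2 = 4 * ((D / 4 : ℕ) + 1) + κ.toNat := by
    exact_mod_cast congrArg Nat.cast hD'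
  refine ⟨(D / 4 : ℕ) + 1, ?_⟩
  cases κ <;> simp [Residue.lift] at h2 ⊢ <;> linear_combination hθ + h2

theorem not_hasScalarSquares_splitOrder {D : ℕ} {κ : Bool} (hD : D % 4 = 2 + κ.toNat) {θ : 𝓞 F}
    (hθ : θ ^ 2 = D) (hb : ∀ a : 𝓞 F, ∃ m n : ℤ, a = m + n * θ)
    (hz : ∀ m n : ℤ, (m + n * θ : 𝓞 F) = 0 → m = 0 ∧ n = 0) {w : 𝓞 F}
    (h : Residue.lift θ (!κ, κ) ^ 2 + Residue.lift θ (false, !κ) ^ 2 + 1 = 4 * w)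
    {ε : (𝓞 F)ˣ} {t : F} (ht : 2 * cc ↑ε = t ^ 2) :
    ¬ HasScalarSquares (F := F) (splitOrder F (Residue.lift θ (!κ, κ))
      (Residue.lift θ (false, !κ)) w h) := by
  obtain ⟨T, rfl⟩ : ∃ T : 𝓞 F, cc T = t := by
    apply exists_ringOfIntegers
    apply IsIntegral.of_pow two_pos
    rw [← ht, ← algebraMap_two, ← map_mul]
    exact RingOfIntegers.isIntegral_coe _
  have hT : 2 * (ε : 𝓞 F) = T ^ 2 := by
    apply RingOfIntegers.coe_injective
    simpa [algebraMap_two] using ht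
  obtain ⟨E, hE⟩ : ∃ E : 𝓞 F, (ε : 𝓞 F) * E = 1 := ⟨_, Units.mul_inv ε⟩
  have hE' : cc ↑ε * cc E = 1 := by rw [← map_mul, hE, map_one]
  obtain ⟨⟨p, hp⟩, q, hq⟩ : (∃ p, T - Residue.lift θ (!κ, κ) * T = 2 * p) ∧
      ∃ q, Residue.lift θ (false, !κ) * T = 2 * q := by
    obtain ⟨a, b, rfl⟩ := hb T
    obtain ⟨x, y, hxy⟩ := hb ε
    rw [hxy] at hT
    obtain ⟨hT1, -⟩ := hz (a ^ 2 + D * b ^ 2 - 2 * x) (2 * a * b - 2 * y) (by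
      push_cast
      linear_combination -hT - b ^ 2 * hθ)
    cases κ
    · obtain ⟨k, rfl⟩ : (2 : ℤ) ∣ a := by
        have hD2 : (D : ℤ) = 2 * (D / 2 : ℕ) := by simp at hD; omega
        apply Int.prime_two.dvd_of_dvd_pow (n := 2)
        rw [hD2] at hT1
        exact ⟨x - (D / 2 : ℕ) * b ^ 2, by linear_combination hT1⟩
      have hD2 : (D : 𝓞 F) = 2 * (D / 2 : ℕ) := by
        have : D = 2 * (D / 2) := by simp at hD; omega
        exact_mod_cast congrArg Nat.cast this
      refine ⟨⟨0, by simp [Residue.lift]⟩, k * θ + b * (D / 2 : ℕ), ?_⟩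
      simp [Residue.lift]
      linear_combination b * hθ + b * hD2
    · obtain ⟨k, hk⟩ : (2 : ℤ) ∣ a - b := by
        have hD2 : (D : ℤ) = 2 * (D / 2 : ℕ) + 1 := by simp at hD; omega
        apply Int.prime_two.dvd_of_dvd_pow (n := 2)
        rw [hD2] at hT1
        exact ⟨x - (D / 2 : ℕ) * b ^ 2 - a * b, by linear_combination hT1⟩
      have hD2 : (D : 𝓞 F) = 2 * (D / 2 : ℕ) + 1 := by
        have : D = 2 * (D / 2) + 1 := by simp at hD; omega
        exact_mod_cast congrArg Nat.cast this
      have hk' : (a : 𝓞 F) - b = 2 * k := by exact_mod_cast congrArg Int.cast hk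
      refine ⟨⟨k - k * θ - b * (D / 2 : ℕ), ?_⟩, 0, by simp [Residue.lift]⟩
      simp [Residue.lift]
      linear_combination -b * hθ - b * hD2 + (1 - θ) * hk'
  set u := Residue.lift θ (!κ, κ)
  set v := Residue.lift θ (false, !κ)
  have hp' : cc T - cc u * cc T = 2 * cc p := by simpa [algebraMap_two] using congrArg cc hp
  have hq' : cc v * cc T = 2 * cc q := by simpa [algebraMap_two] using congrArg cc hq
  have hs := splitOrder_isHalfIntegral h
  have hy : (⟨cc T / 2, cc T / 2, 0, 0⟩ : ℍ[F, -1, -1]) ∈ splitOrder F u v w h := by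
    refine ⟨p, -q, T, 0, ?_⟩
    ext <;> simp
    · linear_combination hp' / 2
    · linear_combination -hq' / 2
  have hy' : (⟨cc T / 2, -cc T / 2, 0, 0⟩ : ℍ[F, -1, -1]) ∈ splitOrder F u v w h := by
    convert neg_mem (hs.i_mul_mem hy) using 1
    ext <;> simp [neg_div]
  intro hsq
  obtain ⟨r, hr⟩ := hsq _ hy _ (hs.smul_mem E hy')
    (by ext <;> simp <;> first | ring1 | linear_combination hE' - cc E / 2 * ht)
    (by ext <;> simp <;> first | ring1 | linear_combination hE' - cc E / 2 * ht)
  have h1 := congrArg QuaternionAlgebra.imI hr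
  simp at h1
  simp [h1] at ht

/-- `x` is a scalar multiple of one of `1, i, j, k`. -/
def IsMonomial (x : ℍ[F, -1, -1]) : Prop :=
  (x.imI = 0 ∧ x.imJ = 0 ∧ x.imK = 0) ∨ (x.re = 0 ∧ x.imJ = 0 ∧ x.imK = 0) ∨
    (x.re = 0 ∧ x.imI = 0 ∧ x.imK = 0) ∨ (x.re = 0 ∧ x.imI = 0 ∧ x.imJ = 0)

theorem IsMonomial.of_algebraMap_mul {x : ℍ[F, -1, -1]} {r : F} (hr : r ≠ 0)
    (h : IsMonomial (algebraMap F _ r * x)) : IsMonomial x := by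
  rw [QuaternionAlgebra.algebraMap_eq] at h
  simpa [IsMonomial, hr] using h

theorem IsMonomial.re_sq {x : ℍ[F, -1, -1]} (h : IsMonomial x) (hx : redNorm F x = 1) :
    x.re = 0 ∨ x.re = 1 ∨ x.re = -1 := by
  rw [redNorm_eq] at hx
  obtain ⟨h1, h2, h3⟩ | ⟨h, -⟩ | ⟨h, -⟩ | ⟨h, -⟩ := h
  · right
    rw [h1, h2, h3] at hx
    exact mul_self_eq_one_iff.1 (by linear_combination hx)
  all_goals exact Or.inl h

theorem int_sum_four_squares_eq_four {a b c d : ℤ} (h : a ^ 2 + b ^ 2 + c ^ 2 + d ^ 2 = 4)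
    (heven : 2 ∣ b ∨ 2 ∣ d) :
    (b = 0 ∧ c = 0 ∧ d = 0) ∨ (a = 0 ∧ c = 0 ∧ d = 0) ∨ (a = 0 ∧ b = 0 ∧ d = 0) ∨
      (a = 0 ∧ b = 0 ∧ c = 0) := by
  have hle : ∀ x : ℤ, x ^ 2 ≤ 4 → -2 ≤ x ∧ x ≤ 2 := fun x hx => by constructor <;> nlinarith
  obtain ⟨ha1, ha2⟩ := hle a (by nlinarith)
  obtain ⟨hb1, hb2⟩ := hle b (by nlinarith)
  obtain ⟨hc1, hc2⟩ := hle c (by nlinarith)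
  obtain ⟨hd1, hd2⟩ := hle d (by nlinarith)
  interval_cases a <;> interval_cases b <;> interval_cases c <;> first | omega | skip
  all_goals interval_cases d <;> omega

section SplitOrderUnits

variable {D : ℕ} {κ : Bool} (hD : D % 4 = 2 + κ.toNat) (hD6 : 6 ≤ D) {θ : 𝓞 F}
  (hθ : θ ^ 2 = D) (hb : ∀ a : 𝓞 F, ∃ m n : ℤ, a = m + n * θ)
  (hz : ∀ m n : ℤ, (m + n * θ : 𝓞 F) = 0 → m = 0 ∧ n = 0) {w : 𝓞 F}
  (h : Residue.lift θ (!κ, κ) ^ 2 + Residue.lift θ (false, !κ) ^ 2 + 1 = 4 * w)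
include hD hD6 hθ hb hz

theorem isMonomial_of_redNorm_eq_one {x : ℍ[F, -1, -1]}
    (hx : x ∈ splitOrder F (Residue.lift θ (!κ, κ)) (Residue.lift θ (false, !κ)) w h)
    (hN : redNorm F x = 1) : IsMonomial x := by
  obtain ⟨p, q, b, d, rfl⟩ := hx
  obtain ⟨a, ha⟩ : ∃ a, a = 2 * p + (Residue.lift θ (!κ, κ) * b + Residue.lift θ (false, !κ) * d) :=
    ⟨_, rfl⟩
  obtain ⟨c, hc⟩ : ∃ c, c = 2 * q + (Residue.lift θ (false, !κ) * b + Residue.lift θ (!κ, κ) * d) :=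
    ⟨_, rfl⟩
  have hsum : a ^ 2 + b ^ 2 + c ^ 2 + d ^ 2 = 4 := by
    apply RingOfIntegers.coe_injective
    rw [redNorm_eq] at hN
    simp [ha, hc, algebraMap_two, algebraMap_four]
    simp at hN
    linear_combination 4 * hN
  have hx : (⟨cc p + (cc (Residue.lift θ (!κ, κ)) * cc b +
      cc (Residue.lift θ (false, !κ)) * cc d) / 2,
      cc b / 2, cc q + (cc (Residue.lift θ (false, !κ)) * cc b +
      cc (Residue.lift θ (!κ, κ)) * cc d) / 2,
      cc d / 2⟩ : ℍ[F, -1, -1]) = ⟨cc a / 2, cc b / 2, cc c / 2, cc d / 2⟩ := by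
    ext <;> simp [ha, hc, algebraMap_two] <;> ring
  rw [hx]
  obtain ⟨a0, a1, rfl⟩ := hb a
  obtain ⟨b0, b1, rfl⟩ := hb b
  obtain ⟨c0, c1, rfl⟩ := hb c
  obtain ⟨d0, d1, rfl⟩ := hb d
  obtain ⟨p0, p1, rfl⟩ := hb p
  obtain ⟨h0, -⟩ := hz
    (a0 ^ 2 + b0 ^ 2 + c0 ^ 2 + d0 ^ 2 + D * (a1 ^ 2 + b1 ^ 2 + c1 ^ 2 + d1 ^ 2) - 4)
    (2 * (a0 * a1 + b0 * b1 + c0 * c1 + d0 * d1)) (by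
      push_cast
      linear_combination hsum - (a1 ^ 2 + b1 ^ 2 + c1 ^ 2 + d1 ^ 2 : 𝓞 F) * hθ)
  have hD6' : (6 : ℤ) ≤ D := by exact_mod_cast hD6
  have hs1 : a1 ^ 2 + b1 ^ 2 + c1 ^ 2 + d1 ^ 2 ≤ 0 := by
    by_contra hlt
    nlinarith [sq_nonneg a0, sq_nonneg b0, sq_nonneg c0, sq_nonneg d0]
  obtain rfl : a1 = 0 := by nlinarith [sq_nonneg a1, sq_nonneg b1, sq_nonneg c1, sq_nonneg d1]
  obtain rfl : b1 = 0 := by nlinarith [sq_nonneg b1, sq_nonneg c1, sq_nonneg d1]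
  obtain rfl : c1 = 0 := by nlinarith [sq_nonneg c1, sq_nonneg d1]
  obtain rfl : d1 = 0 := by nlinarith [sq_nonneg d1]
  have heven : 2 ∣ b0 ∨ 2 ∣ d0 := by
    cases κ
    · right
      obtain ⟨-, h1⟩ := hz (2 * p0 + b0 - a0) (2 * p1 + d0) (by
        simp [Residue.lift] at ha ⊢
        linear_combination -ha)
      omega
    · left
      obtain ⟨-, h1⟩ := hz (2 * p0 - a0) (2 * p1 + b0) (by
        simp [Residue.lift] at ha ⊢
        linear_combination -ha)
      omega
  have := int_sum_four_squares_eq_four (a := a0) (b := b0) (c := c0) (d := d0) (by linarith) heven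
  simpa [IsMonomial] using this

variable {σ₀ : F →+* ℝ} {ε : (𝓞 F)ˣ} (hε : 1 < σ₀ (algebraMap (𝓞 F) F ↑ε))
  (hεfund : ∀ u : (𝓞 F)ˣ, 1 < σ₀ (algebraMap (𝓞 F) F ↑u) →
    σ₀ (algebraMap (𝓞 F) F ↑ε) ≤ σ₀ (algebraMap (𝓞 F) F ↑u))
  (hsq : ¬ ∃ t : F, 2 * algebraMap (𝓞 F) F ↑ε = t ^ 2)
include hε hεfund hsq

theorem re_eq_zero_of_redNorm_eq {y : ℍ[F, -1, -1]}
    (hy : y ∈ splitOrder F (Residue.lift θ (!κ, κ)) (Residue.lift θ (false, !κ)) w h)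
    (hN : redNorm F y = cc ↑ε) : y.re = 0 := by
  obtain ⟨E, hE⟩ : ∃ E : 𝓞 F, (ε : 𝓞 F) * E = 1 := ⟨_, Units.mul_inv ε⟩
  have hE' : cc ↑ε * cc E = 1 := by rw [← map_mul, hE, map_one]
  have hzN : redNorm F (algebraMap F ℍ[F, -1, -1] (cc E) * (y * y)) = 1 := by
    rw [redNorm_mul, redNorm_mul, redNorm_algebraMap, hN]
    linear_combination (cc ↑ε * cc E + 1) * hE'
  have hzmem := mul_mem ((splitOrder_isHalfIntegral h).scalar_mem E) (mul_mem hy hy)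
  have hre := (isMonomial_of_redNorm_eq_one hD hD6 hθ hb hz h hzmem hzN).re_sq hzN
  have hzre : (algebraMap F ℍ[F, -1, -1] (cc E) * (y * y)).re = 2 * cc E * y.re ^ 2 - 1 := by
    rw [mul_self_eq, hN]
    simp only [QuaternionAlgebra.algebraMap_eq]
    simp
    linear_combination -hE'
  rw [hzre] at hre
  obtain h1 | h1 | h1 := hre
  · refine absurd ⟨2 * y.re, ?_⟩ hsq
    linear_combination -2 * cc ↑ε * h1 + 4 * y.re ^ 2 * hE'
  · refine absurd ?_ (fundamentalUnit_ne_sq hε hεfund y.re)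
    linear_combination -cc ↑ε / 2 * h1 + y.re ^ 2 * hE'
  · have h2 : y.re ^ 2 = 0 := by linear_combination cc ↑ε / 2 * h1 - y.re ^ 2 * hE'
    exact pow_eq_zero_iff two_ne_zero |>.1 h2

theorem isMonomial_of_unit
    (u : (splitOrder F (Residue.lift θ (!κ, κ)) (Residue.lift θ (false, !κ)) w h)ˣ) :
    IsMonomial ((u : splitOrder F _ _ w h) : ℍ[F, -1, -1]) := by
  have hhalf := splitOrder_isHalfIntegral h
  obtain ⟨n, hn⟩ := hhalf.isOrder.exists_redNorm_eq u
  set x := ((u : splitOrder F _ _ w h) : ℍ[F, -1, -1]) with hx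
  have hxmem : x ∈ splitOrder F _ _ w h := (u : splitOrder F _ _ w h).2
  have h1 : σ₀ (-1) < 0 := by simp
  have hx0 : x ≠ 0 := by
    intro h0
    have := congrArg Subtype.val (u.mul_inv)
    rw [Subring.coe_mul, ← hx, h0] at this
    simp at this
  have hpos := redNorm_pos h1 h1 hx0
  rw [hn] at hpos
  obtain ⟨k, rfl⟩ := unit_eq_zpow_of_pos hε hεfund hpos
  have key : ∀ m : ℤ, algebraMap F _ (cc ↑(ε ^ (-m))) * x ∈ splitOrder F _ _ w h ∧
      redNorm F (algebraMap F ℍ[F, -1, -1] (cc ↑(ε ^ (-m))) * x) = cc ↑(ε ^ (k - 2 * m)) := by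
    intro m
    refine ⟨mul_mem (hhalf.scalar_mem _) hxmem, ?_⟩
    rw [redNorm_mul, redNorm_algebraMap, hn, ← map_pow, ← map_mul, ← Units.val_pow_eq_pow_val,
      ← Units.val_mul, ← zpow_natCast, ← zpow_mul, ← zpow_add]
    congr 3
    push_cast
    ring
  obtain ⟨m, rfl | rfl⟩ := Int.even_or_odd' k
  · obtain ⟨hm1, hm2⟩ := key m
    rw [sub_self, zpow_zero, Units.val_one, map_one] at hm2
    exact (isMonomial_of_redNorm_eq_one hD hD6 hθ hb hz h hm1 hm2).of_algebraMap_mul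
      ((map_ne_zero_iff _ RingOfIntegers.coe_injective).2 (Units.ne_zero _))
  · exfalso
    obtain ⟨hm1, hm2⟩ := key m
    rw [add_sub_cancel_left, zpow_one] at hm2
    set y := algebraMap F ℍ[F, -1, -1] (cc ↑(ε ^ (-m))) * x
    have hre : ∀ z : ℍ[F, -1, -1], z ∈ splitOrder F _ _ w h → redNorm F z = 1 → (z * y).re = 0 :=
      fun z hz1 hz2 => re_eq_zero_of_redNorm_eq hD hD6 hθ hb hz h hε hεfund hsq
        (mul_mem hz1 hm1) (by rw [redNorm_mul, hz2, hm2, one_mul])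
    have e1 := hre 1 (one_mem _) (by simp [redNorm])
    have e2 := hre _ hhalf.i_mem (by simp [redNorm])
    have e3 := hre _ hhalf.j_mem (by simp [redNorm])
    have e4 := hre _ (mul_mem hhalf.i_mem hhalf.j_mem) (by simp [redNorm])
    simp at e1 e2 e3 e4
    rw [redNorm_eq, e1, e2, e3, e4] at hm2
    simp at hm2
    exact (map_ne_zero_iff _ RingOfIntegers.coe_injective).2 (Units.ne_zero ε) hm2.symm

end SplitOrderUnits

section Conjugation

theorem exists_intertwiner_ne_zero {R : Type} [Ring R] {i j i' j' : R} (hi : i * i = -1)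
    (hj : j * j = -1) (hij : j * i = -(i * j)) (hi' : i' * i' = -1) (hj' : j' * j' = -1)
    (hij' : j' * i' = -(i' * j')) (h4 : (4 : R) ≠ 0) :
    ∃ t : R, t ≠ 0 ∧ t * i = i' * t ∧ t * j = j' * t := by
  have hi2 : ∀ z, i * (i * z) = -z := fun z => by rw [← mul_assoc, hi, neg_one_mul]
  have hij2 : ∀ z, j * (i * z) = -(i * (j * z)) := fun z => by
    rw [← mul_assoc, hij, neg_mul, mul_assoc]
  have hi2' : ∀ z, i' * (i' * z) = -z := fun z => by rw [← mul_assoc, hi', neg_one_mul]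
  have hj2' : ∀ z, j' * (j' * z) = -z := fun z => by rw [← mul_assoc, hj', neg_one_mul]
  have hij2' : ∀ z, j' * (i' * z) = -(i' * (j' * z)) := fun z => by
    rw [← mul_assoc, hij', neg_mul, mul_assoc]
  let T : R → R := fun y => y - i' * (y * i) - j' * (y * j) - i' * (j' * (y * (i * j)))
  have hT : ∃ y, T y ≠ 0 := by
    by_contra! hall
    apply h4
    have : T 1 - T i * i - T j * j - T (i * j) * (i * j) = 4 := by
      simp only [T, sub_mul, mul_assoc, hi, hj, hij, hi2, hij2, mul_neg, neg_mul, one_mul, mul_one,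
        neg_neg]
      rw [show (4 : R) = 1 + 1 + 1 + 1 by norm_num]
      abel
    rw [← this]
    simp [hall]
  obtain ⟨y, hy⟩ := hT
  refine ⟨T y, hy, ?_, ?_⟩ <;>
  · simp only [T, mul_sub, sub_mul, mul_assoc, hi, hj, hij, hi2, hi2', hj2', hij2', mul_neg,
      mul_one, neg_neg]
    abel

variable {A B : F} {σ₀ : F →+* ℝ} (hA : σ₀ A < 0) (hB : σ₀ B < 0)
include hA hB

/-- The maximal orders `e(S)` and `e'(S)` are conjugate, for all isomorphisms `e` and `e'`. -/
theorem conjRel_comap_symm (S : Subring ℍ[F, -1, -1]) (e e' : ℍ[F, -1, -1] ≃ₐ[F] ℍ[F, A, B]) :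
    ConjRel (S.comap (e.symm : ℍ[F, A, B] →+* ℍ[F, -1, -1]))
      (S.comap (e'.symm : ℍ[F, A, B] →+* ℍ[F, -1, -1])) := by
  have hI : (⟨0, 1, 0, 0⟩ : ℍ[F, -1, -1]) * ⟨0, 1, 0, 0⟩ = -1 := by ext <;> simp
  have hJ : (⟨0, 0, 1, 0⟩ : ℍ[F, -1, -1]) * ⟨0, 0, 1, 0⟩ = -1 := by ext <;> simp
  have hIJ : (⟨0, 0, 1, 0⟩ : ℍ[F, -1, -1]) * ⟨0, 1, 0, 0⟩ = -(⟨0, 1, 0, 0⟩ * ⟨0, 0, 1, 0⟩) := by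
    ext <;> simp
  have h4 : (4 : ℍ[F, A, B]) ≠ 0 := fun h => by
    have h0 : algebraMap F ℍ[F, A, B] 4 = 0 := (map_ofNat _ 4).trans h
    rw [QuaternionAlgebra.algebraMap_eq, QuaternionAlgebra.ext_iff] at h0
    simpa using h0.1
  obtain ⟨t, ht, hti, htj⟩ := exists_intertwiner_ne_zero
    (by rw [← map_mul, hI]; simp : e _ * e _ = -1) (by rw [← map_mul, hJ]; simp : e _ * e _ = -1)
    (by rw [← map_mul, hIJ, map_neg, map_mul]) (by rw [← map_mul, hI]; simp : e' _ * e' _ = -1)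
    (by rw [← map_mul, hJ]; simp : e' _ * e' _ = -1) (by rw [← map_mul, hIJ, map_neg, map_mul]) h4
  have hty : ∀ y, t * e y = e' y * t := by
    intro y
    have hy : y = algebraMap F _ y.re + algebraMap F _ y.imI * ⟨0, 1, 0, 0⟩ +
        algebraMap F _ y.imJ * ⟨0, 0, 1, 0⟩ +
        algebraMap F _ y.imK * (⟨0, 1, 0, 0⟩ * ⟨0, 0, 1, 0⟩) := by
      simp only [QuaternionAlgebra.algebraMap_eq]
      ext <;> simp
    have hc : ∀ r z, t * (algebraMap F ℍ[F, A, B] r * z) = algebraMap F _ r * (t * z) :=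
      fun r z => by rw [← mul_assoc, ← Algebra.commutes, mul_assoc]
    rw [hy]
    simp only [map_add, map_mul, AlgEquiv.commutes, mul_add, add_mul, hc, mul_assoc, ← hti, ← htj]
    rw [← Algebra.commutes, ← mul_assoc t, hti, mul_assoc, htj]
  obtain ⟨u, rfl⟩ := isUnit_of_ne_zero hA hB ht
  refine ⟨u, fun y => ?_⟩
  have := hty (e.symm y)
  rw [e.apply_symm_apply] at this
  rw [this, mul_assoc, Units.mul_inv, mul_one]
  simp

end Conjugation

theorem splitOrder_isMaximalOrder {u v w : 𝓞 F} (h : u ^ 2 + v ^ 2 + 1 = 4 * w) :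
    IsMaximalOrder F (splitOrder F u v w h) := by
  have hs := splitOrder_isHalfIntegral h
  exact ⟨hs.isOrder, fun O hO hle => (hO.isHalfIntegral (hle hs.i_mem) (hle hs.j_mem)).eq_splitOrder
    h (hle (mem_splitOrder h))⟩

open scoped Classical in
/-- The class of a nonzero scalar multiple of `1, i, j` or `k` in the Klein four-group. -/
def monomialClass (x : ℍ[F, -1, -1]) : DihedralGroup 2 :=
  if x.re ≠ 0 then 1 else if x.imI ≠ 0 then .r 1 else if x.imJ ≠ 0 then .sr 0 else .sr 1

theorem monomialClass_mul {x y : ℍ[F, -1, -1]} (hx : IsMonomial x) (hy : IsMonomial y)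
    (hx0 : x ≠ 0) (hy0 : y ≠ 0) :
    monomialClass (x * y) = monomialClass x * monomialClass y := by
  obtain ⟨x1, x2, x3, x4⟩ := x
  obtain ⟨y1, y2, y3, y4⟩ := y
  simp only [IsMonomial, ne_eq, QuaternionAlgebra.ext_iff, QuaternionAlgebra.re_zero,
    QuaternionAlgebra.imI_zero, QuaternionAlgebra.imJ_zero, QuaternionAlgebra.imK_zero]
    at hx hy hx0 hy0
  obtain ⟨rfl, rfl, rfl⟩ | ⟨rfl, rfl, rfl⟩ | ⟨rfl, rfl, rfl⟩ | ⟨rfl, rfl, rfl⟩ := hx <;>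
  obtain ⟨rfl, rfl, rfl⟩ | ⟨rfl, rfl, rfl⟩ | ⟨rfl, rfl, rfl⟩ | ⟨rfl, rfl, rfl⟩ := hy <;>
  simp only [and_true, true_and] at hx0 hy0 <;>
  simp [monomialClass, hx0, hy0] <;> decide

section FirstKind

variable {A B : F} {σ₀ : F →+* ℝ} (hA : σ₀ A < 0) (hB : σ₀ B < 0)
include hA hB

theorem redNorm_eq_one_of_mul_self {x : ℍ[F, A, B]} (hx : x * x = -1) : redNorm F x = 1 := by
  have h1 : redNorm F x * redNorm F x = 1 := by
    rw [← redNorm_mul, hx]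
    simp [redNorm]
  obtain h | h := mul_self_eq_one_iff.1 h1
  · exact h
  · have hx0 : x ≠ 0 := by
      rintro rfl
      simp [redNorm] at h
    have := redNorm_pos hA hB hx0
    rw [h] at this
    norm_num at this

theorem redUnitDihedralFirstKind_of_isMonomial {S : Subring ℍ[F, -1, -1]} (hS : IsHalfIntegral S)
    (hmono : ∀ u : Sˣ, IsMonomial ((u : S) : ℍ[F, -1, -1])) (e : ℍ[F, -1, -1] ≃ₐ[F] ℍ[F, A, B]) :
    RedUnitDihedralFirstKind F 2 (S.comap (e.symm : ℍ[F, A, B] →+* ℍ[F, -1, -1])) := by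
  set O := S.comap (e.symm : ℍ[F, A, B] →+* ℍ[F, -1, -1]) with hO
  have horder : IsOrder F O := hS.isOrder.comap_algEquiv e.symm
  have hmono' : ∀ u : Oˣ, IsMonomial (e.symm ((u : O) : ℍ[F, A, B])) := by
    intro u
    refine hmono ⟨⟨e.symm ((u : O) : ℍ[F, A, B]), (u : O).2⟩,
      ⟨e.symm (((u⁻¹ : Oˣ) : O) : ℍ[F, A, B]), ((u⁻¹ : Oˣ) : O).2⟩, Subtype.ext ?_, Subtype.ext ?_⟩
    · change e.symm _ * e.symm _ = 1
      rw [← map_mul, ← Subring.coe_mul, Units.mul_inv, Subring.coe_one, map_one]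
    · change e.symm _ * e.symm _ = 1
      rw [← map_mul, ← Subring.coe_mul, Units.inv_mul, Subring.coe_one, map_one]
  have hne : ∀ u : Oˣ, e.symm ((u : O) : ℍ[F, A, B]) ≠ 0 := by
    intro u h0
    have h1 := congrArg (fun z : O => e.symm (z : ℍ[F, A, B])) u.mul_inv
    simp only [Subring.coe_mul, map_mul, h0, Subring.coe_one, map_one, zero_mul] at h1
    exact zero_ne_one h1
  let φ : Oˣ →* DihedralGroup 2 := MonoidHom.mk'
    (fun u => monomialClass (e.symm ((u : O) : ℍ[F, A, B]))) fun u v => by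
      rw [Units.val_mul, Subring.coe_mul, map_mul]
      exact monomialClass_mul (hmono' u) (hmono' v) (hne u) (hne v)
  have hrep : ∀ g : DihedralGroup 2, g ≠ 1 → ∃ u : Oˣ, φ u = g ∧
      redNorm F ((u : O) : ℍ[F, A, B]) = 1 := by
    have key : ∀ b : ℍ[F, -1, -1], b ∈ S → b * b = -1 → ∃ u : Oˣ, φ u = monomialClass b ∧
        redNorm F ((u : O) : ℍ[F, A, B]) = 1 := by
      intro b hb hbb
      have heb : e b * e b = -1 := by rw [← map_mul, hbb, map_neg, map_one]
      have hmem : e b ∈ O := by simpa [hO] using hb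
      refine ⟨⟨⟨e b, hmem⟩, -⟨e b, hmem⟩, Subtype.ext ?_, Subtype.ext ?_⟩, ?_,
        redNorm_eq_one_of_mul_self hA hB heb⟩
      · simp [heb]
      · simp [heb]
      · exact congrArg monomialClass (e.symm_apply_apply b)
    have hk : (⟨0, 0, 0, 1⟩ : ℍ[F, -1, -1]) ∈ S := by
      simpa using hS.i_mul_mem hS.j_mem
    obtain ⟨u1, h1, h1'⟩ := key _ hS.i_mem (by ext <;> simp)
    obtain ⟨u2, h2, h2'⟩ := key _ hS.j_mem (by ext <;> simp)
    obtain ⟨u3, h3, h3'⟩ := key _ hk (by ext <;> simp)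
    have hg : ∀ g : DihedralGroup 2, g ≠ 1 → g = .r 1 ∨ g = .sr 0 ∨ g = .sr 1 := by decide
    intro g hg1
    obtain rfl | rfl | rfl := hg g hg1
    · exact ⟨u1, by simp [h1, monomialClass], h1'⟩
    · exact ⟨u2, by simp [h2, monomialClass], h2'⟩
    · exact ⟨u3, by simp [h3, monomialClass], h3'⟩
  refine ⟨φ, fun g => ?_, fun u => ⟨fun h => ?_, ?_⟩, fun u hu _ => ?_⟩
  · by_cases hg : g = 1
    · exact ⟨1, by rw [hg, map_one]⟩
    · obtain ⟨u, hu, -⟩ := hrep g hg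
      exact ⟨u, hu⟩
  · obtain ⟨n, hn⟩ := horder.exists_redNorm_eq u
    have hu : e.symm ((u : O) : ℍ[F, A, B]) =
        algebraMap F _ (e.symm ((u : O) : ℍ[F, A, B])).re := by
      have h1 : (e.symm ((u : O) : ℍ[F, A, B])).re ≠ 0 := by
        intro h0
        change monomialClass _ = 1 at h
        have h2 : (DihedralGroup.r 1 : DihedralGroup 2) ≠ 1 := by decide
        have h3 : (DihedralGroup.sr 0 : DihedralGroup 2) ≠ 1 := by decide
        have h4 : (DihedralGroup.sr 1 : DihedralGroup 2) ≠ 1 := by decide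
        unfold monomialClass at h
        split_ifs at h <;> contradiction
      have h2 := hmono' u
      simp only [IsMonomial, h1, false_and, or_false] at h2
      rw [QuaternionAlgebra.algebraMap_eq]
      ext <;> simp [h2]
    set r := (e.symm ((u : O) : ℍ[F, A, B])).re
    have hu' : ((u : O) : ℍ[F, A, B]) = algebraMap F _ r := by
      rw [← e.commutes, ← hu, e.apply_symm_apply]
    rw [hu', redNorm_algebraMap] at hn
    obtain ⟨a, ha⟩ : ∃ a : 𝓞 F, cc a = r := by
      apply exists_ringOfIntegers
      apply IsIntegral.of_pow two_pos
      rw [hn]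
      exact RingOfIntegers.isIntegral_coe _
    have han : a ^ 2 = n := by
      apply RingOfIntegers.coe_injective
      rw [map_pow, ha, hn]
    have hunit : IsUnit a := (isUnit_pow_iff two_ne_zero).1 (han ▸ n.isUnit)
    obtain ⟨a, rfl⟩ := hunit
    exact ⟨a, by rw [hu', ha]⟩
  · rintro ⟨r, hr⟩
    change monomialClass _ = 1
    rw [hr, e.symm.commutes, QuaternionAlgebra.algebraMap_eq]
    simp [monomialClass]
  · obtain ⟨u', h1, h2⟩ := hrep _ hu
    exact ⟨u', h1, 1, by simp [h2]⟩

end FirstKind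

section Existence

variable {A B : F} {O : Subring ℍ[F, A, B]} (hmax : IsMaximalOrder F O)
  (hfirst : RedUnitDihedralFirstKind F 2 O) (σ₀ : F →+* ℝ)
include hmax hfirst σ₀

theorem RedUnitDihedralFirstKind.exists_algEquiv :
    HasScalarSquares (F := F) O ∧ ∃ e : ℍ[F, -1, -1] ≃ₐ[F] ℍ[F, A, B],
      (⟨0, 1, 0, 0⟩ : ℍ[F, -1, -1]) ∈ O.comap (e : ℍ[F, -1, -1] →+* ℍ[F, A, B]) ∧
      (⟨0, 0, 1, 0⟩ : ℍ[F, -1, -1]) ∈ O.comap (e : ℍ[F, -1, -1] →+* ℍ[F, A, B]) := by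
  obtain ⟨⟨i, hi, j, hj, hii, hjj, hji⟩, hsq⟩ :=
    RedUnitDihedralFirstKind.exists_generators hmax.1 hfirst
  obtain ⟨e, rfl, rfl⟩ := exists_algEquiv_of_generators (σ₀ := σ₀) hii hjj hji
  exact ⟨hasScalarSquares_of_units hsq, e, hi, hj⟩

theorem RedUnitDihedralFirstKind.false_of_unramified {θ : 𝓞 F} {D : ℕ} (hθ : θ ^ 2 = θ + D)
    (hb : ∀ a : 𝓞 F, ∃ m n : ℤ, a = m + n * θ)
    (hz : ∀ m n : ℤ, (m + n * θ : 𝓞 F) = 0 → m = 0 ∧ n = 0) : False := by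
  obtain ⟨hsq, e, hi, hj⟩ := hfirst.exists_algEquiv hmax σ₀
  exact (hsq.comap_algEquiv e).false_of_unramified (hmax.comap_algEquiv e) hi hj hθ hb hz

theorem RedUnitDihedralFirstKind.exists_eq_comap_splitOrder {θ : 𝓞 F} {D : ℕ} {κ : Bool}
    (hD : D % 4 = 2 + κ.toNat) (hθ : θ ^ 2 = D) (hb : ∀ a : 𝓞 F, ∃ m n : ℤ, a = m + n * θ)
    (hz : ∀ m n : ℤ, (m + n * θ : 𝓞 F) = 0 → m = 0 ∧ n = 0) {w : 𝓞 F}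
    (h : Residue.lift θ (!κ, κ) ^ 2 + Residue.lift θ (false, !κ) ^ 2 + 1 = 4 * w) :
    HasScalarSquares (F := F)
      (splitOrder F (Residue.lift θ (!κ, κ)) (Residue.lift θ (false, !κ)) w h) ∧
    ∃ e : ℍ[F, -1, -1] ≃ₐ[F] ℍ[F, A, B],
      O = (splitOrder F (Residue.lift θ (!κ, κ)) (Residue.lift θ (false, !κ)) w h).comap
        (e.symm : ℍ[F, A, B] →+* ℍ[F, -1, -1]) := by
  obtain ⟨hsq, e, hi, hj⟩ := hfirst.exists_algEquiv hmax σ₀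
  obtain ⟨τ, hτ⟩ := (hsq.comap_algEquiv e).exists_comap_eq_splitOrder (hmax.comap_algEquiv e) hi hj
    hD hθ hb hz h
  rw [← hτ]
  refine ⟨(hsq.comap_algEquiv e).comap_algEquiv τ, τ.trans e, ?_⟩
  ext x
  simp [Subring.mem_comap]

end Existence

end Auxiliary

/-- **Refined type number for `D₂†`** -/
theorem typeNum_D2_first_kind
    (d : ℕ) (hd6 : 6 ≤ d) (hdsf : Squarefree d)
    (sqrtd : F) (hsqrtd : sqrtd ^ 2 = (d : F))
    (hgen : Algebra.adjoin ℚ {sqrtd} = ⊤)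
    (σ₀ : F →+* ℝ) (hσ₀ : 0 < σ₀ sqrtd)
    -- `ε` is the fundamental unit of `F`: the smallest unit greater than `1`
    (ε : (𝓞 F)ˣ) (hε : 1 < σ₀ (algebraMap (𝓞 F) F ↑ε))
    (hεfund : ∀ u : (𝓞 F)ˣ, 1 < σ₀ (algebraMap (𝓞 F) F ↑u) →
      σ₀ (algebraMap (𝓞 F) F ↑ε) ≤ σ₀ (algebraMap (𝓞 F) F ↑u))
    -- `H = ℍ[F, A, B]` is a totally definite quaternion `F`-algebra (every totally
    -- definite quaternion algebra admits such a presentation)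
    (A B : F) (hdef : ∀ σ : F →+* ℝ, σ A < 0 ∧ σ B < 0) :
    (Nonempty (ℍ[F, A, B] ≃ₐ[F] ℍ[F, -1, -1]) ∧ (d % 4 = 2 ∨ d % 4 = 3) ∧
        ¬(∃ t : F, 2 * algebraMap (𝓞 F) F ↑ε = t ^ 2) →
      typeNumDnFirstKind F A B 2 = 1) ∧
    (¬(Nonempty (ℍ[F, A, B] ≃ₐ[F] ℍ[F, -1, -1]) ∧ (d % 4 = 2 ∨ d % 4 = 3) ∧
        ¬(∃ t : F, 2 * algebraMap (𝓞 F) F ↑ε = t ^ 2)) →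
      typeNumDnFirstKind F A B 2 = 0) := by
  have hramified : d % 4 = 2 ∨ d % 4 = 3 → ∃ (κ : Bool) (θ : 𝓞 F), d % 4 = 2 + κ.toNat ∧
      θ ^ 2 = d ∧ (∀ a : 𝓞 F, ∃ m n : ℤ, a = m + n * θ) ∧
      ∀ m n : ℤ, (m + n * θ : 𝓞 F) = 0 → m = 0 ∧ n = 0 := by
    intro hd
    obtain ⟨θ, -, hθ, hb, hz⟩ := exists_basis_of_ramified hd6 hdsf hsqrtd hgen hd
    obtain hd | hd := hd
    · exact ⟨false, θ, hd, hθ, hb, hz⟩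
    · exact ⟨true, θ, hd, hθ, hb, hz⟩
  have hA := (hdef σ₀).1
  have hB := (hdef σ₀).2
  refine ⟨fun ⟨⟨e⟩, hd, hsq⟩ => ?_, fun hnot => ?_⟩
  · obtain ⟨κ, θ, hd, hθ, hb, hz⟩ := hramified hd
    obtain ⟨w, hw⟩ := exists_four_mul_eq hd hθ
    refine Nat.card_eq_one_iff_unique.2 ⟨⟨?_⟩, ⟨Quot.mk _
      ⟨(splitOrder F _ _ w hw).comap (e : ℍ[F, A, B] →+* ℍ[F, -1, -1]), ?_, ?_⟩⟩⟩
    · rintro ⟨O, hO, hO'⟩ ⟨P, hP, hP'⟩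
      apply Quot.sound
      obtain ⟨-, e₁, rfl⟩ := hO'.exists_eq_comap_splitOrder hO σ₀ hd hθ hb hz hw
      obtain ⟨-, e₂, rfl⟩ := hP'.exists_eq_comap_splitOrder hP σ₀ hd hθ hb hz hw
      exact conjRel_comap_symm hA hB _ e₁ e₂
    · exact (splitOrder_isMaximalOrder hw).comap_algEquiv e
    · exact redUnitDihedralFirstKind_of_isMonomial hA hB (splitOrder_isHalfIntegral hw)
        (isMonomial_of_unit hd hd6 hθ hb hz hw hε hεfund hsq) e.symm
  · refine Nat.card_eq_zero.2 (Or.inl ⟨Quot.ind ?_⟩)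
    rintro ⟨O, hO, hO'⟩
    obtain ⟨-, e, -⟩ := hO'.exists_algEquiv hO σ₀
    have hd : d % 4 = 2 ∨ d % 4 = 3 := by
      by_contra hd
      have h0 : d % 4 ≠ 0 := fun h0 => by
        have := hdsf 2 (Nat.dvd_of_mod_eq_zero h0)
        simp at this
      obtain ⟨θ, hθ, hb, hz⟩ := exists_basis_of_unramified hd6 hdsf hsqrtd hgen
        (D := (d / 4 : ℕ)) (by omega)
      exact hO'.false_of_unramified hO σ₀ (by rw [hθ, Int.cast_natCast]) hb hz
    obtain ⟨κ, θ, hκ, hθ, hb, hz⟩ := hramified hd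
    obtain ⟨w, hw⟩ := exists_four_mul_eq hκ hθ
    obtain ⟨hS, -⟩ := hO'.exists_eq_comap_splitOrder hO σ₀ hκ hθ hb hz hw
    exact hnot ⟨⟨e.symm⟩, hd, fun ⟨t, ht⟩ =>
      not_hasScalarSquares_splitOrder hκ hθ hb hz hw ht hS⟩

end QuatPaper
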